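/- arXiv:math/0501109 — 2 statements merged into one kernel-verified Lean document; each statement's English description precedes it below -/
import Mathlib

section
/- Let N be a positive integer and let y, z ∈ S_N with z ≤ y in the Bruhat order. Then, taking closures in GL_N(ℂ) with the subspace Zariski topology: (a) the closure of U⁻_z·z ∩ B_N⁺ y B_N⁺ equals U⁻_z·z ∩ (closure of B_N⁺ y B_N⁺), which equals the disjoint union over all w ∈ S_N with z ≤ w ≤ y of U⁻_z·z ∩ B_N⁺ w B_N⁺; (b) the closure of U⁻·z ∩ B_N⁺ y B_N⁺ equals U⁻·z ∩ (closure of B_N⁺ y B_N⁺), which equals the disjoint union over all w with z ≤ w ≤ y of U⁻·z ∩ B_N⁺ w B_N⁺; (c) the closure of B_N⁻·z ∩ B_N⁺ y B_N⁺ equals B_N⁻·z ∩ (closure of B_N⁺ y B_N⁺), which equals the disjoint union over all w with z ≤ w ≤ y of B_N⁻·z ∩ B_N⁺ w B_N⁺. -/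
open Matrix

noncomputable section

abbrev Mat (k l : ℕ) := Matrix (Fin k) (Fin l) ℂ

/-- permutation matrix: (i,j) entry is 1 exactly when i = w j -/
def permMat (k : ℕ) (w : Equiv.Perm (Fin k)) : Mat k k :=
  fun i j => if i = w j then 1 else 0

/-- invertible upper triangular matrices -/
def Bp (k : ℕ) : Set (Mat k k) := {M | IsUnit M ∧ ∀ i j : Fin k, j < i → M i j = 0}

/-- invertible lower triangular matrices -/
def Bm (k : ℕ) : Set (Mat k k) := {M | IsUnit M ∧ ∀ i j : Fin k, i < j → M i j = 0}

def dcPlus {k l : ℕ} (w : Mat k l) : Set (Mat k l) :=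
  {x | ∃ b ∈ Bp k, ∃ b' ∈ Bp l, x = b * w * b'}

def dcMinus {k l : ℕ} (w : Mat k l) : Set (Mat k l) :=
  {x | ∃ b ∈ Bm k, ∃ b' ∈ Bm l, x = b * w * b'}

/-- comparison of finsets: sorted lists compare termwise -/
def finsetLE {k : ℕ} (A B : Finset (Fin k)) : Prop :=
  List.Forall₂ (· ≤ ·) (A.sort (· ≤ ·)) (B.sort (· ≤ ·))

/-- Bruhat order on S_k -/
def bruhatLE {k : ℕ} (y z : Equiv.Perm (Fin k)) : Prop :=
  ∀ p : Fin k, finsetLE ((Finset.Iic p).image y) ((Finset.Iic p).image z)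

/-- Zariski closure in the space of k×l matrices -/
def zClosure {k l : ℕ} (S : Set (Mat k l)) : Set (Mat k l) :=
  {x | ∀ p : MvPolynomial (Fin k × Fin l) ℂ,
      (∀ y ∈ S, MvPolynomial.eval (fun q => y q.1 q.2) p = 0) →
      MvPolynomial.eval (fun q => x q.1 q.2) p = 0}

def revP (k : ℕ) : Equiv.Perm (Fin k) := ⟨Fin.rev, Fin.rev, Fin.rev_rev, Fin.rev_rev⟩

def fe (m n : ℕ) : Fin n ⊕ Fin m ≃ Fin (m + n) :=
  finSumFinEquiv.trans (finCongr (Nat.add_comm n m))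

/-- the block matrix [[w∘ⁿ, 0],[x, w∘ᵐ]] -/
def embMat (m n : ℕ) (x : Mat m n) : Mat (m+n) (m+n) :=
  Matrix.reindex (fe m n) (fe m n)
    (Matrix.fromBlocks (permMat n (revP n)) 0 x (permMat m (revP m)))

/-- the permutation (w∘ⁿ,w∘ᵐ) ∈ S_{m+n} -/
def wnmPerm (m n : ℕ) : Equiv.Perm (Fin (m+n)) :=
  ((fe m n).symm.trans (Equiv.sumCongr (revP n) (revP m))).trans (fe m n)

def Pset (m n : ℕ) (w : Equiv.Perm (Fin (m+n))) : Set (Mat m n) :=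
  {x | embMat m n x ∈ dcPlus (permMat (m+n) w)}

/-- the matrix with t×t identity in upper-left corner, zeros elsewhere -/
def Imn (m n t : ℕ) : Mat m n := fun i j => if (i:ℕ) = (j:ℕ) ∧ (i:ℕ) < t then 1 else 0

/-- diagonal matrix with first t diagonal entries 0 and the rest 1 -/
def Jk (k t : ℕ) : Mat k k := fun i j => if (i:ℕ) = (j:ℕ) ∧ t ≤ (i:ℕ) then 1 else 0

noncomputable def subRank {k l : ℕ} (x : Mat k l) (R : Finset (Fin k)) (C : Finset (Fin l)) : ℕ :=
  (x.submatrix (fun i : {a // a ∈ R} => i.1) (fun j : {a // a ∈ C} => j.1)).rank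

/-- v(1) < ⋯ < v(t) -/
def headMono {k : ℕ} (t : ℕ) (v : Equiv.Perm (Fin k)) : Prop :=
  ∀ i j : Fin k, i < j → (j:ℕ) < t → v i < v j

/-- u(t+1) < ⋯ < u(k) -/
def tailMono {k : ℕ} (t : ℕ) (u : Equiv.Perm (Fin k)) : Prop :=
  ∀ i j : Fin k, i < j → t ≤ (i:ℕ) → u i < u j

def embPerm {k t : ℕ} (h : t ≤ k) (τ : Equiv.Perm (Fin t)) : Equiv.Perm (Fin k) :=
  τ.viaFintypeEmbedding (Fin.castLEEmb h)
/-- U⁻: lower triangular, unipotent -/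
def Um (N : ℕ) : Set (Mat N N) :=
  {M | (∀ i j : Fin N, i < j → M i j = 0) ∧ ∀ i, M i i = 1}

/-- U⁻_z = U⁻ ∩ z U⁻ z⁻¹ -/
def UmZ (N : ℕ) (z : Equiv.Perm (Fin N)) : Set (Mat N N) :=
  Um N ∩ {M | ∃ u ∈ Um N, M = permMat N z * u * permMat N z⁻¹}

/-- closure in GL_N(ℂ) with the subspace Zariski topology -/
def closGL (N : ℕ) (S : Set (Mat N N)) : Set (Mat N N) :=
  zClosure S ∩ {M | IsUnit M}


/-! ### Combinatorics of the Bruhat order -/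

/-- number of `a ≤ p` with `q ≤ w a` -/
def rk {N : ℕ} (w : Equiv.Perm (Fin N)) (p q : Fin N) : ℕ :=
  (Finset.univ.filter (fun a : Fin N => a ≤ p ∧ q ≤ w a)).card

lemma forall2_countP {k : ℕ} {l l' : List (Fin k)} (h : List.Forall₂ (· ≤ ·) l l') (q : Fin k) :
    l.countP (fun x => decide (q ≤ x)) ≤ l'.countP (fun x => decide (q ≤ x)) := by
  induction h with
  | nil => simp
  | @cons a b t t' hab _ ih =>
    simp only [List.countP_cons, decide_eq_true_eq]
    have : q ≤ a → q ≤ b := fun h => h.trans hab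
    split_ifs <;> omega

lemma forall2_of_countP {k : ℕ} : ∀ (l l' : List (Fin k)), l.length = l'.length →
    l.Pairwise (· ≤ ·) → l'.Pairwise (· ≤ ·) →
    (∀ q : Fin k, l.countP (fun x => decide (q ≤ x)) ≤ l'.countP (fun x => decide (q ≤ x))) →
    List.Forall₂ (· ≤ ·) l l' := by
  intro l
  induction l with
  | nil =>
    intro l' hl _ _ _
    have : l' = [] := List.length_eq_zero_iff.mp hl.symm
    subst this; exact List.Forall₂.nil
  | cons a t ih =>
    intro l' hl hs hs' hc
    cases l' with
    | nil => simp at hl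
    | cons b t' =>
      have hlt : t.length = t'.length := by simpa using hl
      rw [List.pairwise_cons] at hs hs'
      have full : ∀ (q : Fin k) (s : List (Fin k)), (∀ x ∈ s, q ≤ x) →
          s.countP (fun x => decide (q ≤ x)) = s.length := by
        intro q s h
        rw [List.countP_eq_length]
        intro x hx; simpa using h x hx
      have hab : a ≤ b := by
        by_contra hlt'
        have h1 := hc a
        rw [full a (a :: t) (by
          intro x hx
          rcases List.mem_cons.mp hx with rfl | hx
          · exact le_rfl
          · exact hs.1 x hx)] at h1
        rw [List.countP_cons] at h1
        have h2 : t'.countP (fun x => decide (a ≤ x)) ≤ t'.length := List.countP_le_length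
        simp [hlt'] at h1
        omega
      refine List.Forall₂.cons hab (ih t' hlt hs.2 hs'.2 ?_)
      intro q
      by_cases hqb : q ≤ b
      · rw [full q t' (fun x hx => hqb.trans (hs'.1 x hx)), ← hlt]
        exact List.countP_le_length
      · have hqa : ¬ q ≤ a := fun h => hqb (h.trans hab)
        have := hc q
        simpa [List.countP_cons, hqa, hqb] using this

lemma countP_sort {k : ℕ} (A : Finset (Fin k)) (q : Fin k) :
    (A.sort (· ≤ ·)).countP (fun x => decide (q ≤ x)) = (A.filter (fun x => q ≤ x)).card := by
  rw [← Multiset.coe_countP (fun x => q ≤ x), Finset.sort_eq, Multiset.countP_eq_card_filter]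
  rfl

lemma finsetLE_iff {k : ℕ} (A B : Finset (Fin k)) (h : A.card = B.card) :
    finsetLE A B ↔ ∀ q : Fin k, (A.filter (fun x => q ≤ x)).card ≤ (B.filter (fun x => q ≤ x)).card := by
  constructor
  · intro h q
    rw [← countP_sort, ← countP_sort]
    exact forall2_countP h q
  · intro hc
    refine forall2_of_countP _ _ (by simp [h]) (Finset.pairwise_sort _ _) (Finset.pairwise_sort _ _) ?_
    intro q
    rw [countP_sort, countP_sort]; exact hc q

lemma bruhat_iff {N : ℕ} (w y : Equiv.Perm (Fin N)) :
    bruhatLE w y ↔ ∀ p q : Fin N, rk w p q ≤ rk y p q := by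
  have key : ∀ (w : Equiv.Perm (Fin N)) (p q : Fin N),
      (((Finset.Iic p).image w).filter (fun x => q ≤ x)).card = rk w p q := by
    intro w p q
    rw [Finset.filter_image, Finset.card_image_of_injective _ w.injective]
    unfold rk
    congr 1
    ext a; simp
  unfold bruhatLE
  refine forall_congr' fun p => ?_
  rw [finsetLE_iff _ _ (by
    rw [Finset.card_image_of_injective _ w.injective, Finset.card_image_of_injective _ y.injective])]
  simp_rw [key]

lemma rk_split {N : ℕ} (w : Equiv.Perm (Fin N)) (p q : Fin N) :
    rk w p q = ∑ a : Fin N, if a ≤ p ∧ q ≤ w a then 1 else 0 := by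
  unfold rk; rw [Finset.card_filter]

/-- the combinatorial step in the chain property -/
lemma chain_step {N : ℕ} (w y : Equiv.Perm (Fin N)) (hwy : ∀ p q, rk w p q ≤ rk y p q)
    (hne : w ≠ y) : ∃ p j : Fin N, p < j ∧ w p < w j ∧
      (∀ a b, rk (w * Equiv.swap p j) a b ≤ rk y a b) ∧
      ∑ a, ∑ b, rk w a b < ∑ a, ∑ b, rk (w * Equiv.swap p j) a b := by
  classical
  have hex : ∃ p, w p ≠ y p := by
    by_contra h; push Not at h; exact hne (Equiv.ext h)
  obtain ⟨p, hp, hmin⟩ : ∃ p, w p ≠ y p ∧ ∀ i < p, w i = y i := by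
    have := WellFounded.has_min (wellFounded_lt (α := Fin N)) {p | w p ≠ y p} hex
    obtain ⟨p, hp, hm⟩ := this
    refine ⟨p, hp, fun i hi => ?_⟩
    by_contra h; exact hm i h hi
  have hlt : w p < y p := by
    by_contra hcon
    have hgt : y p < w p := lt_of_le_of_ne (not_lt.mp hcon) (Ne.symm hp)
    have h1 := hwy p (w p)
    have : rk y p (w p) < rk w p (w p) := by
      unfold rk
      apply Finset.card_lt_card
      rw [Finset.ssubset_iff_of_subset]
      · exact ⟨p, by simp, by simp [hgt]⟩
      · intro a ha
        simp only [Finset.mem_filter, Finset.mem_univ, true_and] at ha ⊢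
        refine ⟨ha.1, ?_⟩
        rcases lt_or_eq_of_le ha.1 with h | h
        · rw [hmin a h]; exact ha.2
        · subst h; exact le_rfl
    omega
  have hexj : ∃ j, p < j ∧ w p < w j ∧ w j ≤ y p := by
    refine ⟨w.symm (y p), ?_, by simpa using hlt, by simp⟩
    by_contra h
    rcases lt_or_eq_of_le (not_lt.mp h) with h | h
    · have := hmin _ h
      simp only [Equiv.apply_symm_apply] at this
      exact absurd (y.injective this) (ne_of_gt h)
    · have : w (w.symm (y p)) = w p := by rw [h]
      simp at this; exact hp this.symm
  obtain ⟨j, ⟨hpj, hwpj, hwjy⟩, hjmin⟩ :=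
    WellFounded.has_min (wellFounded_lt (α := Fin N)) {j | p < j ∧ w p < w j ∧ w j ≤ y p} hexj
  have hno : ∀ i, p ≤ i → i < j → w i ≤ w p ∨ y p < w i := by
    intro i hi hij
    by_contra hcon
    push Not at hcon
    refine hjmin i ⟨lt_of_le_of_ne hi ?_, hcon.1, hcon.2⟩ hij
    rintro rfl; exact lt_irrefl _ hcon.1
  have hsw : ∀ a b, rk (w * Equiv.swap p j) a b =
      rk w a b + if (p ≤ a ∧ a < j ∧ w p < b ∧ b ≤ w j) then 1 else 0 := by
    intro a b
    have hrest : ∀ f : Fin N → ℕ, ∑ i, f i = f p + f j + ∑ i ∈ (Finset.univ.erase p).erase j, f i := by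
      intro f
      rw [← Finset.add_sum_erase _ f (Finset.mem_univ p),
        ← Finset.add_sum_erase (Finset.univ.erase p) f (a := j) (by simp [hpj.ne'])]
      ring
    rw [rk_split, rk_split, hrest, hrest (fun i => if i ≤ a ∧ b ≤ w i then 1 else 0)]
    have : ∑ i ∈ (Finset.univ.erase p).erase j, (if i ≤ a ∧ b ≤ (w * Equiv.swap p j) i then 1 else 0)
       = ∑ i ∈ (Finset.univ.erase p).erase j, (if i ≤ a ∧ b ≤ w i then 1 else 0) := by
      apply Finset.sum_congr rfl
      intro i hi
      simp only [Finset.mem_erase, Finset.mem_univ, and_true] at hi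
      simp [Equiv.swap_apply_of_ne_of_ne hi.2 hi.1]
    rw [this]
    simp only [Equiv.Perm.mul_apply, Equiv.swap_apply_left, Equiv.swap_apply_right]
    split_ifs <;> omega
  refine ⟨p, j, hpj, hwpj, ?_, ?_⟩
  · intro a b
    rw [hsw]
    split_ifs with hc
    · obtain ⟨hpa, haj, hpb, hbj⟩ := hc
      have hb : b ≤ y p := hbj.trans hwjy
      -- split by values above `y p`
      have hsplit : ∀ v : Equiv.Perm (Fin N), rk v a b =
          (Finset.univ.filter (fun i : Fin N => i ≤ a ∧ y p < v i)).card +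
          (Finset.univ.filter (fun i : Fin N => i ≤ a ∧ b ≤ v i ∧ v i ≤ y p)).card := by
        intro v
        unfold rk
        rw [← Finset.card_union_of_disjoint]
        · congr 1
          ext i
          simp only [Finset.mem_filter, Finset.mem_univ, true_and, Finset.mem_union]
          constructor
          · rintro ⟨h1, h2⟩
            rcases lt_or_ge (y p) (v i) with h | h
            · exact Or.inl ⟨h1, h⟩
            · exact Or.inr ⟨h1, h2, h⟩
          · rintro (⟨h1, h2⟩ | ⟨h1, h2, _⟩)
            · exact ⟨h1, hb.trans h2.le⟩
            · exact ⟨h1, h2⟩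
        · rw [Finset.disjoint_filter]
          rintro i _ ⟨_, h⟩ ⟨_, _, h'⟩
          exact absurd h (not_lt.mpr h')
      have h1 : (Finset.univ.filter (fun i : Fin N => i ≤ a ∧ y p < w i)).card ≤
          (Finset.univ.filter (fun i : Fin N => i ≤ a ∧ y p < y i)).card := by
        by_cases hy : (y p : ℕ) + 1 < N
        · have := hwy a ⟨y p + 1, hy⟩
          unfold rk at this
          have e : ∀ x : Fin N, y p < x ↔ (⟨y p + 1, hy⟩ : Fin N) ≤ x := by
            intro x; rw [Fin.lt_def, Fin.le_def]; exact Nat.succ_le_iff.symm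
          simp only [e]
          exact this
        · have : (Finset.univ.filter (fun i : Fin N => i ≤ a ∧ y p < w i)) = ∅ := by
            ext i
            simp only [Finset.mem_filter, Finset.mem_univ, true_and, Finset.notMem_empty, iff_false]
            rintro ⟨_, h⟩
            have := (w i).2
            rw [Fin.lt_def] at h
            omega
          rw [this]; simp
      have h2 : (Finset.univ.filter (fun i : Fin N => i ≤ a ∧ b ≤ w i ∧ w i ≤ y p)).card <
          (Finset.univ.filter (fun i : Fin N => i ≤ a ∧ b ≤ y i ∧ y i ≤ y p)).card := by
        apply Finset.card_lt_card
        have hip : ∀ i, i ≤ a → b ≤ w i → w i ≤ y p → i < p := by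
          intro i hia hbi hiy
          by_contra hcon
          rcases hno i (not_lt.mp hcon) (lt_of_le_of_lt hia haj) with h | h
          · exact absurd (lt_of_lt_of_le hpb hbi) (not_lt.mpr h)
          · exact absurd h (not_lt.mpr hiy)
        rw [Finset.ssubset_iff_of_subset]
        · refine ⟨p, by simp [hpa, hb], ?_⟩
          simp only [Finset.mem_filter, Finset.mem_univ, true_and]
          rintro ⟨h1, h2, h3⟩
          exact lt_irrefl _ (hip p h1 h2 h3)
        · intro i
          simp only [Finset.mem_filter, Finset.mem_univ, true_and]
          rintro ⟨h1, h2, h3⟩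
          rw [← hmin i (hip i h1 h2 h3)]
          exact ⟨h1, h2, h3⟩
      rw [hsplit w, hsplit y]
      omega
    · simpa using hwy a b
  · have hle : ∀ a b, rk w a b ≤ rk (w * Equiv.swap p j) a b := by
      intro a b; rw [hsw]; omega
    apply Finset.sum_lt_sum
    · intro a _; exact Finset.sum_le_sum fun b _ => hle a b
    · refine ⟨p, Finset.mem_univ _, Finset.sum_lt_sum (fun b _ => hle p b) ⟨w j, Finset.mem_univ _, ?_⟩⟩
      rw [hsw]; simp [hpj, hwpj]

/-- Induction principle along the Bruhat order. -/
lemma bruhat_induction {N : ℕ} (y : Equiv.Perm (Fin N)) (P : Equiv.Perm (Fin N) → Prop) (h0 : P y)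
    (hs : ∀ (w : Equiv.Perm (Fin N)) (p j : Fin N), p < j → w p < w j →
      P (w * Equiv.swap p j) → P w)
    (w : Equiv.Perm (Fin N)) (hw : bruhatLE w y) : P w := by
  rw [bruhat_iff] at hw
  have : ∀ n : ℕ, ∀ w : Equiv.Perm (Fin N), (∀ p q, rk w p q ≤ rk y p q) →
      ∑ a, ∑ b, rk y a b ≤ n + ∑ a, ∑ b, rk w a b → P w := by
    intro n
    induction n with
    | zero =>
      intro w hw hn
      by_cases hne : w = y
      · rw [hne]; exact h0
      · obtain ⟨p, j, _, _, hle, hlt⟩ := chain_step w y hw hne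
        have : ∑ a, ∑ b, rk (w * Equiv.swap p j) a b ≤ ∑ a, ∑ b, rk y a b :=
          Finset.sum_le_sum fun a _ => Finset.sum_le_sum fun b _ => hle a b
        omega
    | succ n ih =>
      intro w hw hn
      by_cases hne : w = y
      · rw [hne]; exact h0
      · obtain ⟨p, j, hpj, hw', hle, hlt⟩ := chain_step w y hw hne
        exact hs w p j hpj hw' (ih _ hle (by omega))
  exact this _ w hw (Nat.le_add_right _ _)

lemma bruhat_antisymm {N : ℕ} {w y : Equiv.Perm (Fin N)} (h : bruhatLE w y) (h' : bruhatLE y w) :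
    w = y := by
  rw [bruhat_iff] at h h'
  by_contra hne
  obtain ⟨p, j, _, _, hle, hlt⟩ := chain_step w y h hne
  have : ∑ a, ∑ b, rk (w * Equiv.swap p j) a b ≤ ∑ a, ∑ b, rk w a b :=
    Finset.sum_le_sum fun a _ => Finset.sum_le_sum fun b _ => (hle a b).trans (h' a b)
  omega


/-! ### Triangular matrices and double cosets -/

lemma mul_permMat_apply {N : ℕ} (M : Mat N N) (w : Equiv.Perm (Fin N)) (i j : Fin N) :
    (M * permMat N w) i j = M i (w j) := by
  simp [Matrix.mul_apply, permMat]

lemma permMat_mul_apply {N : ℕ} (M : Mat N N) (w : Equiv.Perm (Fin N)) (i j : Fin N) :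
    (permMat N w * M) i j = M (w⁻¹ i) j := by
  rw [Matrix.mul_apply, Finset.sum_eq_single (w⁻¹ i)]
  · simp [permMat]
  · intro b _ hb
    have : i ≠ w b := by rintro rfl; simp at hb
    simp [permMat, this]
  · simp

lemma Bp_diag {N : ℕ} {M : Mat N N} (h : M ∈ Bp N) (i : Fin N) : M i i ≠ 0 := by
  have h1 : M.det = ∏ i, M i i := Matrix.det_of_isUpperTriangular (fun i j hij => h.2 i j hij)
  have h2 : M.det ≠ 0 := ((Matrix.isUnit_iff_isUnit_det M).mp h.1).ne_zero
  rw [h1, Finset.prod_ne_zero_iff] at h2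
  exact h2 i (Finset.mem_univ _)

lemma Bm_diag {N : ℕ} {M : Mat N N} (h : M ∈ Bm N) (i : Fin N) : M i i ≠ 0 := by
  have h1 : M.det = ∏ i, M i i := Matrix.det_of_isLowerTriangular M (fun i j hij => h.2 i j hij)
  have h2 : M.det ≠ 0 := ((Matrix.isUnit_iff_isUnit_det M).mp h.1).ne_zero
  rw [h1, Finset.prod_ne_zero_iff] at h2
  exact h2 i (Finset.mem_univ _)

lemma Bp_of_diag {N : ℕ} {M : Mat N N} (h : ∀ i j, j < i → M i j = 0) (hd : ∀ i, M i i ≠ 0) :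
    M ∈ Bp N := by
  refine ⟨?_, h⟩
  rw [Matrix.isUnit_iff_isUnit_det, Matrix.det_of_isUpperTriangular (fun i j hij => h i j hij)]
  exact (Finset.prod_ne_zero_iff.mpr fun i _ => hd i).isUnit

lemma Bm_of_diag {N : ℕ} {M : Mat N N} (h : ∀ i j, i < j → M i j = 0) (hd : ∀ i, M i i ≠ 0) :
    M ∈ Bm N := by
  refine ⟨?_, h⟩
  rw [Matrix.isUnit_iff_isUnit_det, Matrix.det_of_isLowerTriangular M (fun i j hij => h i j hij)]
  exact (Finset.prod_ne_zero_iff.mpr fun i _ => hd i).isUnit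

lemma Bp_one {N : ℕ} : (1 : Mat N N) ∈ Bp N :=
  Bp_of_diag (fun _ _ h => Matrix.one_apply_ne h.ne') (fun i => by simp)

lemma Bp_mul {N : ℕ} {a b : Mat N N} (ha : a ∈ Bp N) (hb : b ∈ Bp N) : a * b ∈ Bp N := by
  refine ⟨ha.1.mul hb.1, ?_⟩
  have h1 : a.BlockTriangular id := fun i j hij => ha.2 i j hij
  have h2 : b.BlockTriangular id := fun i j hij => hb.2 i j hij
  exact fun i j hij => (h1.mul h2) hij

lemma Bp_inv {N : ℕ} {a : Mat N N} (ha : a ∈ Bp N) : ∃ b ∈ Bp N, a * b = 1 ∧ b * a = 1 := by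
  have hd : IsUnit a.det := (Matrix.isUnit_iff_isUnit_det a).mp ha.1
  have : Invertible a := ha.1.invertible
  have h1 : a.BlockTriangular id := fun i j hij => ha.2 i j hij
  refine ⟨a⁻¹, ⟨?_, ?_⟩, Matrix.mul_nonsing_inv a hd, Matrix.nonsing_inv_mul a hd⟩
  · exact IsUnit.of_mul_eq_one a (Matrix.nonsing_inv_mul a hd)
  · exact fun i j hij => (Matrix.blockTriangular_inv_of_blockTriangular h1) hij

lemma dc_mul {N : ℕ} {w x a b : Mat N N} (hx : x ∈ dcPlus w) (ha : a ∈ Bp N) (hb : b ∈ Bp N) :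
    a * x * b ∈ dcPlus w := by
  obtain ⟨c, hc, d, hd, rfl⟩ := hx
  exact ⟨a * c, Bp_mul ha hc, d * b, Bp_mul hd hb, by simp only [Matrix.mul_assoc]⟩

lemma dc_mul_left {N : ℕ} {w x a : Mat N N} (hx : x ∈ dcPlus w) (ha : a ∈ Bp N) :
    a * x ∈ dcPlus w := by
  simpa using dc_mul hx ha Bp_one

lemma dc_mul_right {N : ℕ} {w x b : Mat N N} (hx : x ∈ dcPlus w) (hb : b ∈ Bp N) :
    x * b ∈ dcPlus w := by
  simpa using dc_mul hx Bp_one hb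

lemma dc_of_mul {N : ℕ} {w x a b : Mat N N} (ha : a ∈ Bp N) (hb : b ∈ Bp N)
    (hx : a * x * b ∈ dcPlus w) : x ∈ dcPlus w := by
  obtain ⟨a', ha', _, h1⟩ := Bp_inv ha
  obtain ⟨b', hb', h2, _⟩ := Bp_inv hb
  have := dc_mul hx ha' hb'
  rwa [show a' * (a * x * b) * b' = (a' * a) * x * (b * b') by simp only [Matrix.mul_assoc],
    h1, h2, Matrix.one_mul, Matrix.mul_one] at this

lemma isUnit_permMat {N : ℕ} (w : Equiv.Perm (Fin N)) : IsUnit (permMat N w) := by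
  refine IsUnit.of_mul_eq_one (permMat N w⁻¹) ?_
  ext i j
  rw [mul_permMat_apply]
  simp only [permMat, Matrix.one_apply]
  simp

lemma dc_isUnit {N : ℕ} {w : Equiv.Perm (Fin N)} {x : Mat N N} (hx : x ∈ dcPlus (permMat N w)) :
    IsUnit x := by
  obtain ⟨b, hb, b', hb', rfl⟩ := hx
  exact (hb.1.mul (isUnit_permMat w)).mul hb'.1

/-! ### Minors -/

/-- rows used for the minor attached to `w, p, q` -/
abbrev RowIx {N : ℕ} (w : Equiv.Perm (Fin N)) (p q : Fin N) := {i : Fin N // q ≤ i ∧ w⁻¹ i ≤ p}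

/-- the submatrix attached to `w, p, q` -/
def minorMat {N : ℕ} (w : Equiv.Perm (Fin N)) (p q : Fin N) (x : Mat N N) :
    Matrix (RowIx w p q) (RowIx w p q) ℂ :=
  fun i j => x i.1 (w⁻¹ j.1)

lemma card_RowIx {N : ℕ} (w : Equiv.Perm (Fin N)) (p q : Fin N) :
    Fintype.card (RowIx w p q) = rk w p q := by
  rw [Fintype.card_subtype]
  unfold rk
  refine Eq.trans ?_ (Finset.card_image_of_injective _ w.injective)
  congr 1
  ext i
  simp only [Finset.mem_filter, Finset.mem_univ, true_and, Finset.mem_image]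
  constructor
  · rintro ⟨h1, h2⟩; exact ⟨w⁻¹ i, ⟨h2, by simpa using h1⟩, by simp⟩
  · rintro ⟨a, ⟨h1, h2⟩, rfl⟩; exact ⟨h2, by simpa using h1⟩

lemma minor_le {N : ℕ} {w y : Equiv.Perm (Fin N)} {p q : Fin N} {g : Mat N N}
    (hg : g ∈ dcPlus (permMat N y)) (hdet : (minorMat w p q g).det ≠ 0) :
    rk w p q ≤ rk y p q := by
  obtain ⟨b, hb, b', hb', rfl⟩ := hg
  set K := {k : Fin N // k ≤ p ∧ q ≤ y k} with hK
  let A : Matrix (RowIx w p q) K ℂ := fun i k => b i.1 (y k.1)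
  let C : Matrix K (RowIx w p q) ℂ := fun k j => b' k.1 (w⁻¹ j.1)
  have hfac : minorMat w p q (b * permMat N y * b') = A * C := by
    ext i j
    have hl : minorMat w p q (b * permMat N y * b') i j =
        ∑ k, b i.1 (y k) * b' k (w⁻¹ j.1) := by
      unfold minorMat
      rw [Matrix.mul_apply]
      simp only [mul_permMat_apply]
    have hr : (A * C) i j = ∑ k : K, b i.1 (y k.1) * b' k.1 (w⁻¹ j.1) := Matrix.mul_apply
    rw [hl, hr, ← Finset.sum_subtype (Finset.univ.filter (fun k : Fin N => k ≤ p ∧ q ≤ y k))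
      (by simp) (fun k => b i.1 (y k) * b' k (w⁻¹ j.1))]
    symm
    apply Finset.sum_subset (Finset.filter_subset _ _)
    intro k _ hk
    simp only [Finset.mem_filter, Finset.mem_univ, true_and, not_and_or, not_le] at hk
    rcases hk with hk | hk
    · rw [hb'.2 _ _ (lt_of_le_of_lt j.2.2 hk), mul_zero]
    · rw [hb.2 _ _ (lt_of_lt_of_le hk i.2.1), zero_mul]
  have hu : IsUnit (minorMat w p q (b * permMat N y * b')) :=
    (Matrix.isUnit_iff_isUnit_det _).mpr (isUnit_iff_ne_zero.mpr hdet)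
  have h1 := Matrix.rank_of_isUnit _ hu
  rw [card_RowIx, hfac] at h1
  have h2 := Matrix.rank_mul_le_left A C
  have h3 := Matrix.rank_le_card_width A
  have h4 : Fintype.card K = rk y p q := by rw [Fintype.card_subtype]; rfl
  omega

lemma minor_lower_ne_zero {N : ℕ} {z : Equiv.Perm (Fin N)} {p q : Fin N} {x : Mat N N}
    (h0 : ∀ i j, i < z j → x i j = 0) (h1 : ∀ j, x (z j) j ≠ 0) :
    (minorMat z p q x).det ≠ 0 := by
  rw [Matrix.det_of_isLowerTriangular]
  · refine Finset.prod_ne_zero_iff.mpr fun i _ => ?_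
    have := h1 (z⁻¹ i.1)
    simpa [minorMat] using this
  · intro i j hij
    refine h0 _ _ ?_
    simpa using hij

lemma lower_bruhat {N : ℕ} {z w : Equiv.Perm (Fin N)} {x : Mat N N}
    (h0 : ∀ i j, i < z j → x i j = 0) (h1 : ∀ j, x (z j) j ≠ 0)
    (hx : x ∈ dcPlus (permMat N w)) : bruhatLE z w := by
  rw [bruhat_iff]
  exact fun p q => minor_le hx (minor_lower_ne_zero h0 h1)

/-- polynomial map criterion -/
lemma zClosure_poly {N : ℕ} {S T : Set (Mat N N)} (φ : Mat N N → Mat N N)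
    (P : Fin N → Fin N → MvPolynomial (Fin N × Fin N) ℂ)
    (hP : ∀ m i j, φ m i j = MvPolynomial.eval (fun q => m q.1 q.2) (P i j))
    (hST : ∀ m ∈ S, φ m ∈ T) {x : Mat N N} (hx : x ∈ zClosure S) : φ x ∈ zClosure T := by
  intro f hf
  have e : ∀ m : Mat N N, MvPolynomial.eval (fun q => φ m q.1 q.2) f =
      MvPolynomial.eval (fun q => m q.1 q.2) (MvPolynomial.bind₁ (fun q => P q.1 q.2) f) := by
    intro m
    rw [← MvPolynomial.coe_aeval_eq_eval, ← MvPolynomial.coe_aeval_eq_eval]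
    simp only [RingHom.coe_coe]
    rw [MvPolynomial.aeval_bind₁]
    congr 2
    ext q
    rw [hP, ← MvPolynomial.coe_aeval_eq_eval]; rfl
  rw [e]
  apply hx
  intro m hm
  rw [← e]
  exact hf _ (hST m hm)

lemma zClosure_mul {N : ℕ} {w x a b : Mat N N} (ha : a ∈ Bp N) (hb : b ∈ Bp N)
    (hx : x ∈ zClosure (dcPlus w)) : a * x * b ∈ zClosure (dcPlus w) := by
  refine zClosure_poly (fun m => a * m * b)
    (fun i j => ∑ l, (∑ k, MvPolynomial.C (a i k) * MvPolynomial.X (k, l)) * MvPolynomial.C (b l j))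
    ?_ (fun m hm => dc_mul hm ha hb) hx
  intro m i j
  simp [Matrix.mul_apply]

lemma closure_bruhat {N : ℕ} {y w : Equiv.Perm (Fin N)} {x : Mat N N}
    (hx : x ∈ zClosure (dcPlus (permMat N y))) (hw : x ∈ dcPlus (permMat N w)) :
    bruhatLE w y := by
  have hw' : permMat N w ∈ zClosure (dcPlus (permMat N y)) := by
    obtain ⟨b, hb, b', hb', rfl⟩ := hw
    obtain ⟨c, hc, _, h1⟩ := Bp_inv hb
    obtain ⟨c', hc', h2, _⟩ := Bp_inv hb'
    have := zClosure_mul hc hc' hx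
    rwa [show c * (b * permMat N w * b') * c' = (c * b) * permMat N w * (b' * c') by
      simp only [Matrix.mul_assoc], h1, h2, Matrix.one_mul, Matrix.mul_one] at this
  rw [bruhat_iff]
  intro p q
  by_contra hlt
  let P : MvPolynomial (Fin N × Fin N) ℂ :=
    Matrix.det (Matrix.of fun i j : RowIx w p q => MvPolynomial.X (i.1, w⁻¹ j.1))
  have hP : ∀ m : Mat N N, MvPolynomial.eval (fun q => m q.1 q.2) P = (minorMat w p q m).det := by
    intro m
    simp only [P]
    rw [RingHom.map_det]
    congr 1
    ext i j
    simp [minorMat]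
  have h0 := hw' P (by
    intro g hg
    rw [hP]
    by_contra hne
    exact hlt (minor_le hg hne))
  rw [hP] at h0
  refine minor_lower_ne_zero ?_ ?_ h0
  · intro i j hij; simp [permMat, hij.ne]
  · intro j; simp [permMat]

lemma dc_disjoint {N : ℕ} {w w' : Equiv.Perm (Fin N)} {x : Mat N N}
    (h : x ∈ dcPlus (permMat N w)) (h' : x ∈ dcPlus (permMat N w')) : w = w' :=
  bruhat_antisymm (closure_bruhat (fun _ hp => hp x h') h) (closure_bruhat (fun _ hp => hp x h) h')


/-! ### Elementary operations and the Bruhat decomposition -/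

/-- left multiplication by `rowOp i₀ u` adds `u i` times row `i₀` to row `i` -/
def rowOp {N : ℕ} (i₀ : Fin N) (u : Fin N → ℂ) : Mat N N :=
  fun i i' => (if i = i' then 1 else 0) + (if i' = i₀ then u i else 0)

/-- right multiplication by `colOp k v` adds `v j` times column `k` to column `j` -/
def colOp {N : ℕ} (k : Fin N) (v : Fin N → ℂ) : Mat N N :=
  fun j j' => (if j = j' then 1 else 0) + (if j = k then v j' else 0)

lemma rowOp_mul {N : ℕ} (i₀ : Fin N) (u : Fin N → ℂ) (h : Mat N N) (i j : Fin N) :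
    (rowOp i₀ u * h) i j = h i j + u i * h i₀ j := by
  simp [rowOp, Matrix.mul_apply, add_mul, Finset.sum_add_distrib]

lemma mul_colOp {N : ℕ} (k : Fin N) (v : Fin N → ℂ) (h : Mat N N) (i j : Fin N) :
    (h * colOp k v) i j = h i j + h i k * v j := by
  simp [colOp, Matrix.mul_apply, mul_add, Finset.sum_add_distrib]

lemma rowOp_mem {N : ℕ} {i₀ : Fin N} {u : Fin N → ℂ} (h : ∀ i, i₀ < i → u i = 0)
    (h0 : 1 + u i₀ ≠ 0) : rowOp i₀ u ∈ Bp N := by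
  refine Bp_of_diag ?_ ?_
  · intro i j hij
    simp only [rowOp, if_neg hij.ne', zero_add]
    split_ifs with h'
    · subst h'; exact h i hij
    · rfl
  · intro i
    simp only [rowOp, if_true]
    split_ifs with h'
    · subst h'; exact h0
    · simp

lemma colOp_mem {N : ℕ} {k : Fin N} {v : Fin N → ℂ} (h : ∀ i, i < k → v i = 0)
    (h0 : 1 + v k ≠ 0) : colOp k v ∈ Bp N := by
  refine Bp_of_diag ?_ ?_
  · intro i j hij
    simp only [colOp, if_neg hij.ne', zero_add]
    split_ifs with h'
    · subst h'; exact h j hij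
    · rfl
  · intro i
    simp only [colOp, if_true]
    split_ifs with h'
    · subst h'; exact h0
    · simp

lemma bruhat_partial {N : ℕ} (g : Mat N N) (hg : IsUnit g) (n : ℕ) (hn : n ≤ N) :
    ∃ a ∈ Bp N, ∃ b ∈ Bp N, ∃ f : Fin N → Fin N, ∀ j : Fin N, (j : ℕ) < n →
      (∀ i, (a * g * b) i j = if i = f j then 1 else 0) ∧
      (∀ j', (a * g * b) (f j) j' = if j' = j then 1 else 0) := by
  induction n with
  | zero => exact ⟨1, Bp_one, 1, Bp_one, id, fun j hj => absurd hj (Nat.not_lt_zero _)⟩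
  | succ n ih =>
    obtain ⟨a, ha, b, hb, f, hf⟩ := ih (Nat.le_of_succ_le hn)
    set h := a * g * b with hh
    have hu : IsUnit h := (ha.1.mul hg).mul hb.1
    let k : Fin N := ⟨n, hn⟩
    have hex : ∃ i, h i k ≠ 0 := by
      by_contra hcon
      push Not at hcon
      exact ((Matrix.isUnit_iff_isUnit_det h).mp hu).ne_zero (Matrix.det_eq_zero_of_column_eq_zero k hcon)
    obtain ⟨i₀, hi₀, hmax⟩ : ∃ i₀, h i₀ k ≠ 0 ∧ ∀ i, i₀ < i → h i k = 0 := by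
      obtain ⟨m, hm, hm'⟩ := WellFounded.has_min (wellFounded_gt (α := Fin N)) {i | h i k ≠ 0} hex
      refine ⟨m, hm, fun i hi => ?_⟩
      by_contra hc; exact hm' i hc hi
    have hlt : ∀ j : Fin N, (j : ℕ) < n → j ≠ k := by
      rintro j hj rfl; exact lt_irrefl _ hj
    have hrow : ∀ j : Fin N, (j : ℕ) < n → h (f j) k = 0 := by
      intro j hj
      rw [(hf j hj).2 k, if_neg (hlt j hj).symm]
    have hne : ∀ j : Fin N, (j : ℕ) < n → i₀ ≠ f j := by
      intro j hj he
      exact hi₀ (he ▸ hrow j hj)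
    have hz : ∀ j : Fin N, (j : ℕ) < n → h i₀ j = 0 := by
      intro j hj
      rw [(hf j hj).1 i₀, if_neg (hne j hj)]
    set c := h i₀ k with hc
    let u : Fin N → ℂ := fun i => if i = i₀ then c⁻¹ - 1 else - (h i k) / c
    let v : Fin N → ℂ := fun j => if j = k then 0 else - (h i₀ j) / c
    have hL : rowOp i₀ u ∈ Bp N := by
      refine rowOp_mem ?_ ?_
      · intro i hi
        simp [u, hi.ne', hmax i hi]
      · simp [u, hi₀]
    have hR : colOp k v ∈ Bp N := by
      refine colOp_mem ?_ ?_
      · intro j hj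
        simp [v, hz j hj]
      · simp [v]
    have hent : ∀ i j, (rowOp i₀ u * a * g * (b * colOp k v)) i j =
        (h i j + u i * h i₀ j) + (h i k + u i * c) * v j := by
      intro i j
      rw [show rowOp i₀ u * a * g * (b * colOp k v) = (rowOp i₀ u * h) * colOp k v by
        simp only [hh, Matrix.mul_assoc], mul_colOp, rowOp_mul, rowOp_mul]
    refine ⟨rowOp i₀ u * a, Bp_mul hL ha, b * colOp k v, Bp_mul hb hR, Function.update f k i₀, ?_⟩
    intro j hj
    simp only [hent]
    rcases Nat.lt_succ_iff_lt_or_eq.mp hj with hj | hj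
    · rw [Function.update_of_ne (hlt j hj)]
      constructor
      · intro i
        simp [hz j hj, v, (hf j hj).1 i]
      · intro j'
        have : u (f j) = 0 := by simp [u, (hne j hj).symm, hrow j hj]
        rw [this, hrow j hj]
        simp [(hf j hj).2 j']
    · have hjk : j = k := Fin.ext hj
      subst hjk
      rw [Function.update_self]
      constructor
      · intro i
        by_cases hi : i = i₀
        · subst hi; simp [u, v, ← hc]; field_simp; ring
        · simp [u, v, hi, ← hc]; field_simp; ring
      · intro j'
        by_cases hj' : j' = k
        · subst hj'; simp [u, v, ← hc]; field_simp; ring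
        · simp only [u, v, hj', if_true, if_false, ← hc]; field_simp; ring

lemma bruhat_exists {N : ℕ} (g : Mat N N) (hg : IsUnit g) :
    ∃ w : Equiv.Perm (Fin N), g ∈ dcPlus (permMat N w) := by
  obtain ⟨a, ha, b, hb, f, hf⟩ := bruhat_partial g hg N le_rfl
  have hinj : Function.Injective f := by
    intro j j' hjj
    have h1 := (hf j j.2).2 j
    have h2 := (hf j' j'.2).2 j
    rw [hjj, h2] at h1
    by_contra hne
    simp [hne] at h1
  let w : Equiv.Perm (Fin N) := Equiv.ofBijective f (Finite.injective_iff_bijective.mp hinj)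
  refine ⟨w, dc_of_mul ha hb ?_⟩
  refine ⟨1, Bp_one, 1, Bp_one, ?_⟩
  rw [Matrix.one_mul, Matrix.mul_one]
  ext i j
  rw [(hf j j.2).1 i]
  rfl

/-! ### Euclidean closures -/

open Topology Filter

lemma closure_sub_zClosure {N : ℕ} (S : Set (Mat N N)) : closure S ⊆ zClosure S := by
  intro x hx p hp
  have hc : Continuous (fun m : Mat N N => MvPolynomial.eval (fun q : Fin N × Fin N => m q.1 q.2) p) := by
    refine (MvPolynomial.continuous_eval p).comp ?_
    exact continuous_pi fun q => continuous_id.matrix_elem q.1 q.2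
  have hcl : IsClosed {m : Mat N N | MvPolynomial.eval (fun q : Fin N × Fin N => m q.1 q.2) p = 0} :=
    isClosed_singleton.preimage hc
  exact closure_minimal (fun m hm => hp m hm) hcl hx

lemma curve_closure {N : ℕ} (w : Equiv.Perm (Fin N)) (p j : Fin N) (hpj : p < j) (hw : w p < w j) :
    dcPlus (permMat N w) ⊆ closure (dcPlus (permMat N (w * Equiv.swap p j))) := by
  rintro x ⟨b, hb, b', hb', rfl⟩
  let E : Mat N N := fun i a => if i = w j ∧ a = p then 1 else 0
  let m : ℂ → Mat N N := fun ε => permMat N w + ε • E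
  have hm : ∀ ε : ℂ, ε ≠ 0 → m ε ∈ dcPlus (permMat N (w * Equiv.swap p j)) := by
    intro ε hε
    let u : Fin N → ℂ := fun i => if i = w p then -ε⁻¹ else 0
    let v : Fin N → ℂ := fun a => if a = j then -ε⁻¹ else 0
    let d : Fin N → ℂ := fun a => if a = p then ε else if a = j then -ε⁻¹ else 1
    have hL : rowOp (w j) u ∈ Bp N := by
      refine rowOp_mem ?_ ?_
      · intro i hi; simp [u, (hw.trans hi).ne']
      · simp [u, hpj.ne']
    have hR : colOp p v ∈ Bp N := by
      refine colOp_mem ?_ ?_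
      · intro i hi; simp [v, (hi.trans hpj).ne]
      · simp [v, hpj.ne]
    have hD : Matrix.diagonal d ∈ Bp N := by
      refine Bp_of_diag (fun i j hij => Matrix.diagonal_apply_ne _ hij.ne') ?_
      intro i
      simp only [Matrix.diagonal_apply_eq, d]
      split_ifs <;> simp [hε]
    refine dc_of_mul hL hR ⟨1, Bp_one, _, hD, ?_⟩
    ext i a
    have hwpj : w p ≠ w j := hw.ne
    rw [mul_colOp, rowOp_mul, rowOp_mul, Matrix.one_mul, Matrix.mul_diagonal]
    have hme : ∀ i a, m ε i a = (if i = w a then 1 else 0) + ε * (if i = w j ∧ a = p then 1 else 0) :=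
      fun _ _ => rfl
    have hpe : ∀ c, Equiv.swap p j a = c →
        permMat N (w * Equiv.swap p j) i a = if i = w c then 1 else 0 := by
      rintro c rfl; rfl
    simp only [hme, u, v, d]
    by_cases hap : a = p
    · subst hap
      rw [hpe _ (Equiv.swap_apply_left _ _)]
      by_cases hi : i = w a
      · subst hi; simp [hpj.ne, hpj.ne', hε]
      · by_cases hi' : i = w j
        · subst hi'; simp [hpj.ne, hpj.ne', hε]
        · simp [hi, hi', hpj.ne]
    · by_cases haj : a = j
      · subst haj
        rw [hpe _ (Equiv.swap_apply_right _ _)]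
        by_cases hi : i = w p
        · subst hi; simp [hpj.ne, hpj.ne', hε]
        · by_cases hi' : i = w a
          · subst hi'; simp [hpj.ne, hpj.ne', hε]
          · simp [hi, hi', hpj.ne, hpj.ne']
      · rw [hpe _ (Equiv.swap_apply_of_ne_of_ne hap haj)]
        have : j ≠ a := Ne.symm haj
        simp [hap, haj, this]
  have hcont : Continuous (fun ε => b * m ε * b') := by
    have : Continuous m := by
      simp only [m]
      fun_prop
    fun_prop
  have ht : Tendsto (fun ε => b * m ε * b') (𝓝[≠] 0) (𝓝 (b * permMat N w * b')) := by
    have h0 : b * m 0 * b' = b * permMat N w * b' := by simp [m]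
    rw [← h0]
    exact (hcont.tendsto 0).mono_left nhdsWithin_le_nhds
  refine mem_closure_of_tendsto ht ?_
  filter_upwards [self_mem_nhdsWithin] with ε hε
  exact dc_mul (hm ε hε) hb hb'

lemma dc_sub_closure {N : ℕ} {w y : Equiv.Perm (Fin N)} (h : bruhatLE w y) :
    dcPlus (permMat N w) ⊆ closure (dcPlus (permMat N y)) := by
  refine bruhat_induction y (fun w => dcPlus (permMat N w) ⊆ closure (dcPlus (permMat N y)))
    subset_closure ?_ w h
  intro w p j hpj hw ih
  exact (curve_closure w p j hpj hw).trans (closure_minimal ih isClosed_closure)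

lemma retract_closure {N : ℕ} {S T : Set (Mat N N)} {x : Mat N N} (φ : Mat N N → Mat N N)
    (hφ : ∀ i j, ContinuousAt (fun m => φ m i j) x) (hx : ∀ i j, φ x i j = x i j)
    (hST : ∀ᶠ m in 𝓝 x, m ∈ S → φ m ∈ T) (hS : x ∈ closure S) : x ∈ closure T := by
  rw [mem_closure_iff_frequently] at hS ⊢
  have hc : ContinuousAt φ x := continuousAt_pi.mpr fun i => continuousAt_pi.mpr fun j => hφ i j
  have ht : Tendsto φ (𝓝 x) (𝓝 x) := by
    have := hc.tendsto
    rwa [show φ x = x from Matrix.ext hx] at this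
  refine ht.frequently ?_
  exact (hS.and_eventually hST).mono fun m hm => hm.2 hm.1

lemma cont_entry {N : ℕ} (i j : Fin N) (x : Mat N N) : ContinuousAt (fun m : Mat N N => m i j) x :=
  (continuous_id.matrix_elem i j).continuousAt

/-! ### The three slices -/

/-- slice for (c) -/
def SliceB {N : ℕ} (z : Equiv.Perm (Fin N)) : Set (Mat N N) := {x | ∀ i j, i < z j → x i j = 0}

/-- slice for (b) -/
def SliceU {N : ℕ} (z : Equiv.Perm (Fin N)) : Set (Mat N N) :=
  SliceB z ∩ {x | ∀ j, x (z j) j = 1}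

/-- slice for (a) -/
def SliceZ {N : ℕ} (z : Equiv.Perm (Fin N)) : Set (Mat N N) :=
  SliceU z ∩ {x | ∀ i j, i < j → x (z i) j = 0}

lemma retract_B {N : ℕ} {z : Equiv.Perm (Fin N)} {y x : Mat N N} (hx : x ∈ SliceB z)
    (hd : ∀ j, x (z j) j ≠ 0) (hy : x ∈ closure (dcPlus y)) :
    x ∈ closure (SliceB z ∩ dcPlus y) := by
  have key : ∀ t : ℕ, x ∈ closure
      ({m | ∀ i j, i < z j → N ≤ (z j : ℕ) + t → m i j = 0} ∩ dcPlus y) := by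
    intro t
    induction t with
    | zero =>
      refine closure_mono ?_ hy
      intro m hm
      refine ⟨fun i j _ h => ?_, hm⟩
      have := (z j).2
      omega
    | succ t ih =>
      by_cases ht : t < N
      · let k : Fin N := ⟨N - (t + 1), by omega⟩
        let k' : Fin N := z⁻¹ k
        have hk' : z k' = k := by simp [k']
        let u : Mat N N → Fin N → ℂ := fun m i => if i < k then - m i k' / m k k' else 0
        have hd' : x k k' ≠ 0 := by rw [← hk']; exact hd k'
        refine retract_closure (fun m => rowOp k (u m) * m) ?_ ?_ ?_ ih
        · intro i j
          simp only [rowOp_mul, u]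
          by_cases hi : i < k
          · simp only [if_pos hi]
            exact (cont_entry i j x).add
              ((((cont_entry i k' x).neg).div (cont_entry k k' x) hd').mul (cont_entry k j x))
          · simp only [if_neg hi, zero_mul, add_zero]
            exact cont_entry i j x
        · intro i j
          rw [rowOp_mul]
          simp only [u]
          split_ifs with hi
          · rw [hx i k' (by rw [hk']; exact hi)]; simp
          · simp
        · filter_upwards [(cont_entry k k' x).eventually_ne hd'] with m hm hmS
          refine ⟨?_, dc_mul_left hmS.2 (rowOp_mem ?_ ?_)⟩
          · intro i j hij hj
            rw [rowOp_mul]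
            simp only [u]
            by_cases hzj : z j = k
            · have hj' : j = k' := by simp [k', ← hzj]
              subst hj'
              rw [if_pos (by rw [← hzj]; exact hij)]
              field_simp
              ring
            · have hlt : N ≤ (z j : ℕ) + t := by
                have : (z j : ℕ) ≠ N - (t + 1) := fun h => hzj (Fin.ext h)
                omega
              have hkz : k < z j := by
                rw [Fin.lt_def]
                change N - (t + 1) < _
                omega
              rw [hmS.1 i j hij hlt, hmS.1 k j hkz hlt]; simp
          · intro i hi; simp only [u]; rw [if_neg (not_lt.mpr hi.le)]
          · simp [u]
      · refine closure_mono ?_ ih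
        rintro m ⟨h1, h2⟩
        exact ⟨fun i j hij _ => h1 i j hij (by omega), h2⟩
  refine closure_mono ?_ (key N)
  rintro m ⟨h1, h2⟩
  exact ⟨fun i j hij => h1 i j hij (by omega), h2⟩

lemma retract_U {N : ℕ} {z : Equiv.Perm (Fin N)} {y x : Mat N N} (hx : x ∈ SliceU z)
    (hy : x ∈ closure (dcPlus y)) : x ∈ closure (SliceU z ∩ dcPlus y) := by
  have h1 := retract_B hx.1 (fun j => by rw [hx.2 j]; exact one_ne_zero) hy
  have hxd : ∀ i, x i (z⁻¹ i) = 1 := fun i => by simpa using hx.2 (z⁻¹ i)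
  refine retract_closure (fun m => Matrix.diagonal (fun i => (m i (z⁻¹ i))⁻¹) * m) ?_ ?_ ?_ h1
  · intro i j
    simp only [Matrix.diagonal_mul]
    exact ((cont_entry i _ x).inv₀ (by rw [hxd]; exact one_ne_zero)).mul (cont_entry i j x)
  · intro i j
    rw [Matrix.diagonal_mul, hxd]; simp
  · have : ∀ᶠ m in 𝓝 x, ∀ i, m i (z⁻¹ i) ≠ 0 := by
      rw [eventually_all]
      intro i
      exact (cont_entry i _ x).eventually_ne (by rw [hxd]; exact one_ne_zero)
    filter_upwards [this] with m hm hmS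
    refine ⟨⟨?_, ?_⟩, dc_mul_left hmS.2 (Bp_of_diag ?_ ?_)⟩
    · intro i j hij
      rw [Matrix.diagonal_mul, hmS.1 i j hij, mul_zero]
    · intro j
      rw [Matrix.diagonal_mul]
      have := hm (z j)
      rw [show z⁻¹ (z j) = j by simp] at this ⊢
      exact inv_mul_cancel₀ this
    · exact fun i j hij => Matrix.diagonal_apply_ne _ hij.ne'
    · intro i; simpa using hm i

lemma retract_Z {N : ℕ} {z : Equiv.Perm (Fin N)} {y x : Mat N N} (hx : x ∈ SliceZ z)
    (hy : x ∈ closure (dcPlus y)) : x ∈ closure (SliceZ z ∩ dcPlus y) := by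
  have key : ∀ t : ℕ, t ≤ N → x ∈ closure
      ((SliceU z ∩ {m | ∀ i j : Fin N, (i : ℕ) < t → i < j → m (z i) j = 0}) ∩ dcPlus y) := by
    intro t
    induction t with
    | zero =>
      intro _
      refine closure_mono ?_ (retract_U hx.1 hy)
      rintro m ⟨h1, h2⟩
      exact ⟨⟨h1, fun i j h => absurd h (Nat.not_lt_zero _)⟩, h2⟩
    | succ t ih =>
      intro ht
      let k : Fin N := ⟨t, ht⟩
      let v : Mat N N → Fin N → ℂ := fun m j => if k < j then - m (z k) j else 0
      refine retract_closure (fun m => m * colOp k (v m)) ?_ ?_ ?_ (ih (Nat.le_of_succ_le ht))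
      · intro i j
        simp only [mul_colOp, v]
        by_cases hj : k < j
        · simp only [if_pos hj]
          exact (cont_entry i j x).add ((cont_entry i k x).mul (cont_entry (z k) j x).neg)
        · simp only [if_neg hj, mul_zero, add_zero]
          exact cont_entry i j x
      · intro i j
        rw [mul_colOp]
        simp only [v]
        split_ifs with hj
        · rw [hx.2 k j hj]; simp
        · simp
      · filter_upwards with m hmS
        obtain ⟨⟨⟨hB, hU⟩, hT⟩, hdc⟩ := hmS
        -- vanishing of the correction term
        have hcor : ∀ i j, i ≤ z j → k < j → m i k * m (z k) j = 0 := by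
          intro i j hij hkj
          by_cases h1 : i < z k
          · rw [hB i k h1, zero_mul]
          · have h2 : z k < z j := by
              refine lt_of_le_of_ne ((not_lt.mp h1).trans hij) ?_
              exact fun h => hkj.ne (z.injective h)
            rw [hB _ _ h2, mul_zero]
        refine ⟨⟨⟨?_, ?_⟩, ?_⟩, dc_mul_right hdc (colOp_mem ?_ ?_)⟩
        · intro i j hij
          rw [mul_colOp, hB i j hij]
          simp only [v]
          split_ifs with hj
          · rw [mul_neg, hcor i j hij.le hj]; simp
          · simp
        · intro j
          rw [mul_colOp, hU j]
          simp only [v]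
          split_ifs with hj
          · rw [mul_neg, hcor (z j) j le_rfl hj]; simp
          · simp
        · intro i j hi hij
          rw [mul_colOp]
          simp only [v]
          rcases Nat.lt_succ_iff_lt_or_eq.mp hi with hi | hi
          · rw [hT i j hi hij, hT i k hi hi]; simp
          · have : i = k := Fin.ext hi
            subst this
            rw [if_pos hij, hU]; ring
        · intro j hj; simp only [v]; rw [if_neg (not_lt.mpr hj.le)]
        · simp [v]
  refine closure_mono ?_ (key N le_rfl)
  rintro m ⟨⟨h1, h2⟩, h3⟩
  exact ⟨⟨h1, fun i j hij => h2 i j i.2 hij⟩, h3⟩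


/-! ### Identification of the slices and the final statement -/

lemma mul_permMat_inv {N : ℕ} (z : Equiv.Perm (Fin N)) (x : Mat N N) :
    x * permMat N z⁻¹ * permMat N z = x := by
  ext i j
  rw [mul_permMat_apply, mul_permMat_apply]; simp

lemma image_Bm {N : ℕ} (z : Equiv.Perm (Fin N)) :
    (fun b => b * permMat N z) '' Bm N = SliceB z ∩ {x | IsUnit x} := by
  ext x
  constructor
  · rintro ⟨b, hb, rfl⟩
    refine ⟨fun i j hij => ?_, hb.1.mul (isUnit_permMat z)⟩
    change (b * permMat N z) i j = 0
    rw [mul_permMat_apply]; exact hb.2 _ _ hij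
  · rintro ⟨h1, h2⟩
    refine ⟨x * permMat N z⁻¹, ⟨IsUnit.mul h2 (isUnit_permMat _), fun i j hij => ?_⟩,
      mul_permMat_inv z x⟩
    rw [mul_permMat_apply]
    exact h1 _ _ (by simpa using hij)

lemma mem_Um_iff {N : ℕ} (z : Equiv.Perm (Fin N)) (u : Mat N N) :
    u * permMat N z ∈ SliceU z ↔ u ∈ Um N := by
  constructor
  · rintro ⟨h1, h2⟩
    refine ⟨fun i j hij => ?_, fun i => ?_⟩
    · have := h1 i (z⁻¹ j) (by simpa using hij)
      rw [mul_permMat_apply] at this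
      simpa using this
    · have := h2 (z⁻¹ i)
      rw [mul_permMat_apply] at this
      simpa using this
  · rintro ⟨h1, h2⟩
    refine ⟨fun i j hij => ?_, fun j => ?_⟩
    · rw [mul_permMat_apply]; exact h1 _ _ hij
    · rw [mul_permMat_apply]; exact h2 _

lemma image_Um {N : ℕ} (z : Equiv.Perm (Fin N)) :
    (fun b => b * permMat N z) '' Um N = SliceU z := by
  ext x
  constructor
  · rintro ⟨b, hb, rfl⟩
    exact (mem_Um_iff z b).mpr hb
  · intro hx
    refine ⟨x * permMat N z⁻¹, (mem_Um_iff z _).mp ?_, mul_permMat_inv z x⟩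
    rwa [mul_permMat_inv]

lemma image_UmZ {N : ℕ} (z : Equiv.Perm (Fin N)) :
    (fun b => b * permMat N z) '' UmZ N z = SliceZ z := by
  ext x
  constructor
  · rintro ⟨b, ⟨hb, u, hu, hbu⟩, rfl⟩
    refine ⟨(mem_Um_iff z b).mpr hb, fun i j hij => ?_⟩
    change (b * permMat N z) (z i) j = 0
    rw [mul_permMat_apply, hbu, mul_permMat_apply, permMat_mul_apply]
    have := hu.1 i j hij
    simpa using this
  · rintro ⟨hx, hx'⟩
    refine ⟨x * permMat N z⁻¹, ⟨(mem_Um_iff z _).mp ?_, permMat N z⁻¹ * x, ⟨?_, ?_⟩, ?_⟩,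
      mul_permMat_inv z x⟩
    · rwa [mul_permMat_inv]
    · intro i j hij
      rw [permMat_mul_apply]
      simpa using hx' i j hij
    · intro i
      rw [permMat_mul_apply]
      simpa using hx.2 i
    · rw [← Matrix.mul_assoc]
      congr 1
      ext i j
      rw [Matrix.mul_assoc, permMat_mul_apply, permMat_mul_apply]
      simp

lemma zClosure_mono {N : ℕ} {S T : Set (Mat N N)} (h : S ⊆ T) : zClosure S ⊆ zClosure T :=
  fun _ hx p hp => hx p (fun m hm => hp m (h hm))

lemma zClosure_entry {N : ℕ} {S : Set (Mat N N)} {i j : Fin N} {c : ℂ}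
    (h : ∀ m ∈ S, m i j = c) {x : Mat N N} (hx : x ∈ zClosure S) : x i j = c := by
  have := hx (MvPolynomial.X (i, j) - MvPolynomial.C c) (by
    intro m hm
    simp [h m hm])
  simpa [sub_eq_zero] using this

lemma closed_B {N : ℕ} {z : Equiv.Perm (Fin N)} {S : Set (Mat N N)} (h : S ⊆ SliceB z) :
    zClosure S ⊆ SliceB z :=
  fun _ hx _ _ hij => zClosure_entry (fun _ hm => h hm _ _ hij) hx

lemma closed_U {N : ℕ} {z : Equiv.Perm (Fin N)} {S : Set (Mat N N)} (h : S ⊆ SliceU z) :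
    zClosure S ⊆ SliceU z :=
  fun _ hx => ⟨closed_B (fun _ hm => (h hm).1) hx, fun _ => zClosure_entry (fun _ hm => (h hm).2 _) hx⟩

lemma closed_Z {N : ℕ} {z : Equiv.Perm (Fin N)} {S : Set (Mat N N)} (h : S ⊆ SliceZ z) :
    zClosure S ⊆ SliceZ z :=
  fun _ hx => ⟨closed_U (fun _ hm => (h hm).1) hx,
    fun _ _ hij => zClosure_entry (fun _ hm => (h hm).2 _ _ hij) hx⟩

lemma slice_main {N : ℕ} (y z : Equiv.Perm (Fin N)) (S : Set (Mat N N))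
    (hcl : ∀ x, x ∈ zClosure (S ∩ dcPlus (permMat N y)) → IsUnit x → x ∈ S)
    (hret : ∀ x ∈ S, x ∈ closure (dcPlus (permMat N y)) →
      x ∈ closure (S ∩ dcPlus (permMat N y)))
    (hlow : ∀ x ∈ S, ∀ w, x ∈ dcPlus (permMat N w) → bruhatLE z w) :
    closGL N (S ∩ dcPlus (permMat N y)) = S ∩ closGL N (dcPlus (permMat N y)) ∧
     S ∩ closGL N (dcPlus (permMat N y)) =
       ⋃ w ∈ {w : Equiv.Perm (Fin N) | bruhatLE z w ∧ bruhatLE w y},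
         S ∩ dcPlus (permMat N w) ∧
     ∀ w w' : Equiv.Perm (Fin N), bruhatLE z w → bruhatLE w y → bruhatLE z w' → bruhatLE w' y →
       w ≠ w' → Disjoint (S ∩ dcPlus (permMat N w)) (S ∩ dcPlus (permMat N w')) := by
  refine ⟨Set.Subset.antisymm ?_ ?_, Set.Subset.antisymm ?_ ?_, ?_⟩
  · rintro x ⟨h1, h2⟩
    exact ⟨hcl x h1 h2, zClosure_mono Set.inter_subset_right h1, h2⟩
  · rintro x ⟨hS, h1, h2⟩
    obtain ⟨w, hw⟩ := bruhat_exists x h2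
    exact ⟨closure_sub_zClosure _ (hret x hS (dc_sub_closure (closure_bruhat h1 hw) hw)), h2⟩
  · rintro x ⟨hS, h1, h2⟩
    obtain ⟨w, hw⟩ := bruhat_exists x h2
    exact Set.mem_biUnion (show w ∈ {w | bruhatLE z w ∧ bruhatLE w y} from
      ⟨hlow x hS w hw, closure_bruhat h1 hw⟩) ⟨hS, hw⟩
  · intro x hx
    obtain ⟨w, ⟨_, hwy⟩, hS, hw⟩ := Set.mem_iUnion₂.mp hx
    exact ⟨hS, closure_sub_zClosure _ (dc_sub_closure hwy hw), dc_isUnit hw⟩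
  · intro w w' _ _ _ _ hne
    rw [Set.disjoint_left]
    rintro x ⟨_, h⟩ ⟨_, h'⟩
    exact hne (dc_disjoint h h')

lemma SliceB_diag {N : ℕ} {z : Equiv.Perm (Fin N)} {x : Mat N N} (hx : x ∈ SliceB z)
    (hu : IsUnit x) (j : Fin N) : x (z j) j ≠ 0 := by
  have : x ∈ (fun b => b * permMat N z) '' Bm N := by rw [image_Bm]; exact ⟨hx, hu⟩
  obtain ⟨b, hb, rfl⟩ := this
  change (b * permMat N z) (z j) j ≠ 0
  rw [mul_permMat_apply]
  exact Bm_diag hb _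

theorem statement1 (N : ℕ) (hN : 0 < N) (y z : Equiv.Perm (Fin N)) (hzy : bruhatLE z y)
    (UzZ : Set (Mat N N)) (hUzZ : UzZ = (fun u => u * permMat N z) '' UmZ N z)
    (Uz : Set (Mat N N)) (hUz : Uz = (fun u => u * permMat N z) '' Um N)
    (Bz : Set (Mat N N)) (hBz : Bz = (fun b => b * permMat N z) '' Bm N) :
    -- (a)
    (closGL N (UzZ ∩ dcPlus (permMat N y)) = UzZ ∩ closGL N (dcPlus (permMat N y)) ∧
     UzZ ∩ closGL N (dcPlus (permMat N y)) =
       ⋃ w ∈ {w : Equiv.Perm (Fin N) | bruhatLE z w ∧ bruhatLE w y},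
         UzZ ∩ dcPlus (permMat N w) ∧
     ∀ w w' : Equiv.Perm (Fin N), bruhatLE z w → bruhatLE w y → bruhatLE z w' → bruhatLE w' y →
       w ≠ w' → Disjoint (UzZ ∩ dcPlus (permMat N w)) (UzZ ∩ dcPlus (permMat N w'))) ∧
    -- (b)
    (closGL N (Uz ∩ dcPlus (permMat N y)) = Uz ∩ closGL N (dcPlus (permMat N y)) ∧
     Uz ∩ closGL N (dcPlus (permMat N y)) =
       ⋃ w ∈ {w : Equiv.Perm (Fin N) | bruhatLE z w ∧ bruhatLE w y},
         Uz ∩ dcPlus (permMat N w) ∧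
     ∀ w w' : Equiv.Perm (Fin N), bruhatLE z w → bruhatLE w y → bruhatLE z w' → bruhatLE w' y →
       w ≠ w' → Disjoint (Uz ∩ dcPlus (permMat N w)) (Uz ∩ dcPlus (permMat N w'))) ∧
    -- (c)
    (closGL N (Bz ∩ dcPlus (permMat N y)) = Bz ∩ closGL N (dcPlus (permMat N y)) ∧
     Bz ∩ closGL N (dcPlus (permMat N y)) =
       ⋃ w ∈ {w : Equiv.Perm (Fin N) | bruhatLE z w ∧ bruhatLE w y},
         Bz ∩ dcPlus (permMat N w) ∧
     ∀ w w' : Equiv.Perm (Fin N), bruhatLE z w → bruhatLE w y → bruhatLE z w' → bruhatLE w' y →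
       w ≠ w' → Disjoint (Bz ∩ dcPlus (permMat N w)) (Bz ∩ dcPlus (permMat N w'))) := by
  subst hUzZ hUz hBz
  rw [image_UmZ, image_Um, image_Bm]
  refine ⟨slice_main y z _ ?_ ?_ ?_, slice_main y z _ ?_ ?_ ?_, slice_main y z _ ?_ ?_ ?_⟩
  · exact fun x hx _ => closed_Z Set.inter_subset_left hx
  · exact fun x hx h => retract_Z hx h
  · exact fun x hx w hw => lower_bruhat hx.1.1 (fun j => by rw [hx.1.2 j]; exact one_ne_zero) hw
  · exact fun x hx _ => closed_U Set.inter_subset_left hx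
  · exact fun x hx h => retract_U hx h
  · exact fun x hx w hw => lower_bruhat hx.1 (fun j => by rw [hx.2 j]; exact one_ne_zero) hw
  · exact fun x hx hu => ⟨closed_B (fun m hm => hm.1.1) hx, hu⟩
  · intro x hx h
    refine closure_mono ?_ (retract_B hx.1 (SliceB_diag hx.1 hx.2) h)
    rintro m ⟨h1, h2⟩
    exact ⟨⟨h1, dc_isUnit h2⟩, h2⟩
  · exact fun x hx w hw => lower_bruhat hx.1 (SliceB_diag hx.1 hx.2) hw
end
end

section
/- Let m, n be positive integers, N = m+n, and let L̄_n = {(g₁,g₂) ∈ GL_N(ℂ) × GL_N(ℂ) : g₁ = [[a,b₁],[0,c]] and g₂ = [[a,b₂],[0,c]] in block form (blocks of sizes n×n, n×m, m×n, m×m) for some a ∈ GL_n(ℂ), c ∈ GL_m(ℂ), b₁, b₂ ∈ M_{n,m}(ℂ)}. Then for every pair (g₁,g₂) ∈ GL_N(ℂ) × GL_N(ℂ) there exist permutations w₁, w₂ ∈ S_N with w₂(1) < ⋯ < w₂(n) and w₂(n+1) < ⋯ < w₂(N), elements b⁺ ∈ B_N⁺, b⁻ ∈ B_N⁻, and (l₁,l₂)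 ∈ L̄_n such that g₁ = b⁺ w₁ l₁ and g₂ = b⁻ w₂ l₂; moreover, the pair (w₁,w₂) is uniquely determined by (g₁,g₂). -/
open Matrix

noncomputable section

/-- L̄_n: pairs of block upper-triangular matrices sharing diagonal blocks -/
def Lbar (m n : ℕ) : Set (Mat (m+n) (m+n) × Mat (m+n) (m+n)) :=
  {g | ∃ (a : Mat n n) (c : Mat m m) (b₁ b₂ : Mat n m), IsUnit a ∧ IsUnit c ∧
    g.1 = Matrix.reindex (fe m n) (fe m n) (Matrix.fromBlocks a b₁ 0 c) ∧
    g.2 = Matrix.reindex (fe m n) (fe m n) (Matrix.fromBlocks a b₂ 0 c)}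


namespace St2

variable {N : ℕ}

/-- invertible and block triangular -/
def T (f : Fin N → ℕ) (M : Mat N N) : Prop := IsUnit M ∧ BlockTriangular M f

lemma T.mul {f : Fin N → ℕ} {A B : Mat N N} (hA : T f A) (hB : T f B) : T f (A * B) :=
  ⟨hA.1.mul hB.1, hA.2.mul hB.2⟩

lemma T.inv {f : Fin N → ℕ} {A : Mat N N} (hA : T f A) : T f A⁻¹ := by
  have := hA.1.invertible
  exact ⟨(Matrix.isUnit_nonsing_inv_iff).2 hA.1, blockTriangular_inv_of_blockTriangular hA.2⟩

lemma T.one (f : Fin N → ℕ) : T f (1 : Mat N N) := ⟨isUnit_one, blockTriangular_one⟩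

lemma mul_inv' {A : Mat N N} (h : IsUnit A) : A * A⁻¹ = 1 :=
  Matrix.mul_nonsing_inv _ ((Matrix.isUnit_iff_isUnit_det A).1 h)

lemma inv_mul' {A : Mat N N} (h : IsUnit A) : A⁻¹ * A = 1 :=
  Matrix.nonsing_inv_mul _ ((Matrix.isUnit_iff_isUnit_det A).1 h)

lemma permMat_mul (w : Equiv.Perm (Fin N)) (A : Mat N N) (i j : Fin N) :
    (permMat N w * A) (w i) j = A i j := by
  simp [Matrix.mul_apply, permMat]

lemma mul_permMat (w : Equiv.Perm (Fin N)) (A : Mat N N) (i j : Fin N) :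
    (A * permMat N w) i j = A i (w j) := by
  simp [Matrix.mul_apply, permMat]

lemma permMat_comp (w v : Equiv.Perm (Fin N)) :
    permMat N w * permMat N v = permMat N (w * v) := by
  ext i j
  rw [mul_permMat]; simp only [permMat, Equiv.Perm.mul_apply]; congr

lemma permMat_one : permMat N 1 = 1 := by
  ext i j; simp only [permMat, Matrix.one_apply, Equiv.Perm.one_apply]; congr

lemma permMat_isUnit (w : Equiv.Perm (Fin N)) : IsUnit (permMat N w) := by
  refine IsUnit.of_mul_eq_one (permMat N w⁻¹) ?_
  rw [permMat_comp]; simp [permMat_one]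

lemma elem_unit (u v : Fin N → ℂ) (h : 1 + v ⬝ᵥ u ≠ 0) :
    IsUnit (1 + vecMulVec u v : Mat N N) := by
  rw [Matrix.isUnit_iff_isUnit_det, Matrix.vecMulVec_eq Unit,
    det_one_add_replicateCol_mul_replicateRow]
  exact isUnit_iff_ne_zero.2 h

lemma step (r f : Fin N → ℕ) (hr : r.Injective) (hf : f.Injective) (g : Mat N N) (hg : IsUnit g)
    (k : ℕ) : ∃ b b' : Mat N N, T r b ∧ T f b' ∧ ∃ w : Fin N → Fin N, ∀ j, f j < k →
      (∀ i, (b * g * b') i j = if i = w j then 1 else 0) ∧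
      (∀ c, (b * g * b') (w j) c = if c = j then 1 else 0) := by
  induction k with
  | zero => exact ⟨1, 1, T.one _, T.one _, id, fun j hj => absurd hj (Nat.not_lt_zero _)⟩
  | succ k ih =>
    obtain ⟨b, b', hb, hb', w, hw⟩ := ih
    by_cases hk : ∃ q, f q = k
    swap
    · refine ⟨b, b', hb, hb', w, fun j hj => hw j ?_⟩
      have : f j ≠ k := fun h => hk ⟨j, h⟩
      omega
    obtain ⟨q, hq⟩ := hk
    set h := b * g * b' with hh
    have hu : IsUnit h := (hb.1.mul hg).mul hb'.1
    have hne : (Finset.univ.filter fun i => h i q ≠ 0).Nonempty := by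
      by_contra hcon
      rw [Finset.not_nonempty_iff_eq_empty, Finset.filter_eq_empty_iff] at hcon
      have : h.det = 0 := Matrix.det_eq_zero_of_column_eq_zero q
        (fun i => by simpa using hcon (Finset.mem_univ i))
      have h2 := (Matrix.isUnit_iff_isUnit_det h).1 hu
      rw [this] at h2
      exact not_isUnit_zero h2
    obtain ⟨i, hi, hmax⟩ := Finset.exists_max_image _ r hne
    simp only [Finset.mem_filter, Finset.mem_univ, true_and] at hi hmax
    have hqj : ∀ j, f j < k → j ≠ q := by rintro j hj rfl; omega
    have hwq : ∀ j, f j < k → h (w j) q = 0 := fun j hj => by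
      rw [(hw j hj).2]; exact if_neg (hqj j hj).symm
    have hwi : ∀ j, f j < k → w j ≠ i := fun j hj e => hi (e ▸ hwq j hj)
    have hij : ∀ j, f j < k → h i j = 0 := fun j hj => by
      rw [(hw j hj).1]; exact if_neg (hwi j hj).symm
    let u : Fin N → ℂ := fun s => if s = i then (h i q)⁻¹ - 1 else - h s q / h i q
    let v : Fin N → ℂ := fun c => if c = q then 0 else - h i c / h i q
    let e : Mat N N := 1 + vecMulVec u (Pi.single i 1)
    let e' : Mat N N := 1 + vecMulVec (Pi.single q 1) v
    have he : T r e := by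
      constructor
      · apply elem_unit
        simp [u, hi]
      · intro s t hst
        have hst' : s ≠ t := by rintro rfl; exact lt_irrefl _ hst
        simp only [e, Matrix.add_apply, Matrix.one_apply_ne hst', vecMulVec_apply, zero_add]
        by_cases ht : t = i
        · subst ht
          have : h s q = 0 := by
            by_contra hc
            exact absurd (hmax s hc) (not_le.2 hst)
          simp [u, hst', this]
        · simp [Pi.single_apply, ht]
    have he' : T f e' := by
      constructor
      · apply elem_unit
        simp [v]
      · intro s t hst
        have hst' : s ≠ t := by rintro rfl; exact lt_irrefl _ hst
        simp only [e', Matrix.add_apply, Matrix.one_apply_ne hst', vecMulVec_apply, zero_add]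
        by_cases ht : s = q
        · subst ht
          simp [v, hst'.symm, hij t (by omega)]
        · simp [Pi.single_apply, ht]
    have h1 : ∀ s c, (e * h) s c = h s c + u s * h i c := by
      intro s c
      simp [e, Matrix.add_mul, Matrix.vecMulVec_mul, vecMulVec_apply]
    have h1q : ∀ s, (e * h) s q = if s = i then 1 else 0 := by
      intro s
      rw [h1]
      by_cases hs : s = i
      · subst hs; simp [u]; field_simp; ring
      · simp [u, hs]; field_simp; ring
    have h2 : ∀ s c, (e * h * e') s c = (e * h) s c + (if s = i then v c else 0) := by
      intro s c
      have : (e * h * e') s c = (e * h) s c + (e * h) s q * v c := by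
        simp [e', Matrix.mul_add, Matrix.mul_vecMulVec, vecMulVec_apply]
      rw [this, h1q]; simp
    refine ⟨e * b, b' * e', he.mul hb, hb'.mul he', fun j => if f j < k then w j else i, ?_⟩
    have hre : e * b * g * (b' * e') = e * h * e' := by simp only [hh, Matrix.mul_assoc]
    rw [hre]
    intro j hj
    by_cases hjk : f j < k
    · simp only [hjk, if_true]
      constructor
      · intro s
        rw [h2, h1, hij j hjk, (hw j hjk).1]
        simp [v, hij j hjk]
      · intro c
        rw [h2, h1, (hw j hjk).2]
        simp [u, hwi j hjk, hwq j hjk]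
    · have : j = q := hf (by omega)
      subst this
      simp only [hjk, if_false]
      constructor
      · intro s
        rw [h2, h1q]; simp [v]
      · intro c
        rw [h2]
        by_cases hc : c = j
        · subst hc; rw [h1q]; simp [v]
        · rw [h1]; simp [v, u, hc]; field_simp; ring

/-- Bruhat decomposition -/
lemma bruhat (r f : Fin N → ℕ) (hr : r.Injective) (hf : f.Injective) (g : Mat N N)
    (hg : IsUnit g) : ∃ b b' : Mat N N, T r b ∧ T f b' ∧ ∃ w : Equiv.Perm (Fin N),
      g = b * permMat N w * b' := by
  obtain ⟨b, b', hb, hb', w, hw⟩ := step r f hr hf g hg (Finset.univ.sup f + 1)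
  have hlt : ∀ j, f j < Finset.univ.sup f + 1 := fun j =>
    Nat.lt_succ_of_le (Finset.le_sup (f := f) (Finset.mem_univ j))
  have hinj : w.Injective := by
    intro j j' e
    have h1 := (hw j (hlt j)).1 (w j)
    have h2 := (hw j' (hlt j')).2 j
    rw [← e, h1] at h2
    by_contra hne
    simp [hne] at h2
  let σ : Equiv.Perm (Fin N) := Equiv.ofBijective w (Finite.injective_iff_bijective.1 hinj)
  refine ⟨b⁻¹, b'⁻¹, hb.inv, hb'.inv, σ, ?_⟩
  have : permMat N σ = b * g * b' := by
    ext i j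
    rw [(hw j (hlt j)).1]; rfl
  rw [this]
  calc g = (b⁻¹ * b) * g * (b' * b'⁻¹) := by rw [inv_mul' hb.1, mul_inv' hb'.1]; simp
    _ = _ := by simp only [Matrix.mul_assoc]

lemma perm_le (r s : Fin N → ℕ) (ρ : Equiv.Perm (Fin N)) (hs : s = r ∘ ρ) (h : ∀ j, s j ≤ r j) :
    s = r := by
  funext j
  have := (Finset.sum_eq_sum_iff_of_le (s := Finset.univ) (f := s) (g := r) fun i _ => h i).1
    (by rw [hs]; exact Equiv.sum_comp ρ r)
  exact this j (Finset.mem_univ j)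

/-- uniqueness lemma -/
lemma uniq (r f : Fin N → ℕ) (hr : r.Injective) (b c : Mat N N) (hb : T r b) (hc : T f c)
    (w w' : Equiv.Perm (Fin N)) (h : b * permMat N w = permMat N w' * c) :
    ∃ ρ : Equiv.Perm (Fin N), w = w' * ρ ∧ ∀ j, f (ρ j) = f j := by
  have hent : ∀ k j, b (w' k) (w j) = c k j := fun k j => by
    rw [← permMat_mul w' c, ← h, mul_permMat]
  have hdet : c.det ≠ 0 := isUnit_iff_ne_zero.1 ((Matrix.isUnit_iff_isUnit_det c).1 hc.1)
  rw [Matrix.det_apply] at hdet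
  obtain ⟨ρ, -, hρ⟩ := Finset.exists_ne_zero_of_sum_ne_zero hdet
  have hne : ∀ j, c (ρ j) j ≠ 0 := fun j hj => hρ (by
    have h0 : ∏ i, c (ρ i) i = 0 := Finset.prod_eq_zero (Finset.mem_univ j) hj
    rw [h0, smul_zero])
  have h1 : f ∘ ρ = f := perm_le f _ ρ rfl fun j => by
    by_contra hcon
    exact hne j (hc.2 (not_le.1 hcon))
  have h2 : (fun j => r (w' (ρ j))) = fun j => r (w j) :=
    perm_le (fun j => r (w j)) _ (w⁻¹ * (w' * ρ)) (by funext j; simp) fun j => by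
      by_contra hcon
      apply hne j
      rw [← hent]
      exact hb.2 (not_le.1 hcon)
  refine ⟨ρ, ?_, fun j => congrFun h1 j⟩
  ext j
  have := hr (congrFun h2 j)
  simp [this]

def fP (n : ℕ) (i : Fin N) : ℕ := if (i : ℕ) < n then 0 else 1
def fB (n : ℕ) (i : Fin N) : ℕ := if (i : ℕ) < n then n - 1 - i else 2 * N - i
def rU (i : Fin N) : ℕ := i
def rL (i : Fin N) : ℕ := N - i

lemma rU_inj : (rU (N := N)).Injective := fun _ _ h => Fin.ext h
lemma rL_inj : (rL (N := N)).Injective := fun i j h => Fin.ext (by unfold rL at h; omega)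

lemma fB_lt (n : ℕ) (hn : n ≤ N) (i j : Fin N) :
    fB n j < fB n i ↔ fP n j < fP n i ∨ (fP n i = fP n j ∧ i < j) := by
  unfold fB fP
  rw [Fin.lt_def]
  have := i.2
  have := j.2
  by_cases hi : (i : ℕ) < n <;> by_cases hj : (j : ℕ) < n <;>
    simp [hi, hj] <;> omega

lemma fB_inj (n : ℕ) (hn : n ≤ N) : (fB n (N := N)).Injective := fun i j h => Fin.ext (by
  unfold fB at h
  split_ifs at h <;> omega)

lemma mem_Bp (M : Mat N N) : M ∈ Bp N ↔ T rU M := Iff.rfl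

lemma mem_Bm (M : Mat N N) : M ∈ Bm N ↔ T rL M := by
  unfold Bm T BlockTriangular rL
  refine and_congr_right fun _ => ?_
  refine forall₂_congr fun i j => ?_
  rw [Fin.lt_def, show (N - (j : ℕ) < N - i) ↔ (i : ℕ) < j by omega]

lemma sort_exists (n : ℕ) (w : Equiv.Perm (Fin N)) : ∃ ρ : Equiv.Perm (Fin N),
    (∀ j, fP n (ρ j) = fP n j) ∧ ∀ i j, i < j → fP n i = fP n j → (w * ρ) i < (w * ρ) j := by
  let F : Fin N → ℕ := fun j => if (j : ℕ) < n then w j else w j + N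
  have hm := Tuple.monotone_sort F
  set ρ := Tuple.sort F
  have hP : Monotone (fP n ∘ ρ) := by
    intro i j hij
    have := hm hij
    have h1 := (w (ρ i)).2
    have h2 := (w (ρ j)).2
    simp only [F, Function.comp, fP] at this ⊢
    by_cases hi : (ρ i : ℕ) < n <;> by_cases hj : (ρ j : ℕ) < n <;>
      simp only [hi, hj, if_true, if_false] at this ⊢ <;> omega
  have h0 : Monotone (fP n ∘ (1 : Equiv.Perm (Fin N))) := by
    intro i j hij
    rw [Fin.le_def] at hij
    simp only [Function.comp, fP, Equiv.Perm.one_apply]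
    by_cases hi : (i : ℕ) < n <;> by_cases hj : (j : ℕ) < n <;>
      simp only [hi, hj, if_true, if_false] <;> omega
  have he := Tuple.unique_monotone hP h0
  refine ⟨ρ, fun j => congrFun he j, fun i j hij hf => ?_⟩
  have h1 : fP n (ρ i) = fP n (ρ j) := by
    have := congrFun he i
    have h' := congrFun he j
    simp only [Function.comp, Equiv.Perm.one_apply] at this h'
    omega
  have h2 := hm hij.le
  have h3 : (w * ρ) i ≠ (w * ρ) j := fun h => hij.ne ((w * ρ).injective h)
  rw [lt_iff_le_and_ne]
  refine ⟨?_, h3⟩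
  rw [Fin.le_def]
  simp only [F, Function.comp, fP, Equiv.Perm.mul_apply] at h1 h2 ⊢
  split_ifs at h1 h2 <;> omega

lemma mono_iff (n : ℕ) (w : Equiv.Perm (Fin N)) : (headMono n w ∧ tailMono n w) ↔
    ∀ i j, i < j → fP n i = fP n j → w i < w j := by
  constructor
  · rintro ⟨h, t⟩ i j hij hf
    have h1 := h i j hij
    have h2 := t i j hij
    unfold fP at hf
    rw [Fin.lt_def] at hij
    split_ifs at hf
    · exact h1 ‹_›
    · exact h2 (by omega)
  · intro h
    refine ⟨fun i j hij hj => h i j hij ?_, fun i j hij hj => h i j hij ?_⟩ <;>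
    · rw [Fin.lt_def] at hij
      unfold fP
      split_ifs <;> omega

lemma mono_unique (n : ℕ) (w w' ρ : Equiv.Perm (Fin N)) (e : w = w' * ρ)
    (hρ : ∀ j, fP n (ρ j) = fP n j)
    (h : ∀ i j, i < j → fP n i = fP n j → w i < w j)
    (h' : ∀ i j, i < j → fP n i = fP n j → w' i < w' j) : w = w' := by
  have hm : Monotone ρ := by
    intro i j hij
    rcases hij.eq_or_lt with rfl | hij
    · rfl
    by_contra hcon
    rw [not_le] at hcon
    by_cases hf : fP n i = fP n j
    · have h1 := h i j hij hf
      have h2 := h' (ρ j) (ρ i) hcon (by rw [hρ, hρ, hf])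
      rw [e] at h1
      exact lt_asymm h1 h2
    · have h1 := hρ i
      have h2 := hρ j
      rw [Fin.lt_def] at hij hcon
      unfold fP at h1 h2 hf
      split_ifs at h1 h2 hf <;> omega
  have h1 := Tuple.unique_monotone (f := (id : Fin N → Fin N)) (σ := ρ) (τ := 1) hm monotone_id
  have : ρ = 1 := by
    ext j
    exact congrArg Fin.val (congrFun h1 j)
  rw [e, this, mul_one]

lemma fe_inl (m n : ℕ) (i : Fin n) : ((fe m n (Sum.inl i) : Fin (m + n)) : ℕ) = i := by
  simp [fe]
lemma fe_inr (m n : ℕ) (i : Fin m) : ((fe m n (Sum.inr i) : Fin (m + n)) : ℕ) = n + i := by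
  simp [fe, Nat.add_comm]

lemma fP_inl (m n : ℕ) (i : Fin n) : fP n (fe m n (Sum.inl i)) = 0 := by
  simp [fP, fe_inl]
lemma fP_inr (m n : ℕ) (i : Fin m) : fP n (fe m n (Sum.inr i)) = 1 := by
  simp [fP, fe_inr]

lemma isUnit_block (m n : ℕ) (a : Mat n n) (b : Mat n m) (c : Mat m m) :
    IsUnit (Matrix.reindex (fe m n) (fe m n) (Matrix.fromBlocks a b 0 c)) ↔
      IsUnit a ∧ IsUnit c := by
  rw [Matrix.isUnit_iff_isUnit_det, Matrix.isUnit_iff_isUnit_det a,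
    Matrix.isUnit_iff_isUnit_det c, Matrix.det_reindex_self, det_fromBlocks_zero₂₁,
    IsUnit.mul_iff]

lemma tri_block (m n : ℕ) (a : Mat n n) (b : Mat n m) (c : Mat m m) :
    BlockTriangular (Matrix.reindex (fe m n) (fe m n) (Matrix.fromBlocks a b 0 c)) (fP n) := by
  intro i j hij
  obtain ⟨i, rfl⟩ := (fe m n).surjective i
  obtain ⟨j, rfl⟩ := (fe m n).surjective j
  rcases i with i | i <;> rcases j with j | j <;> simp [fP_inl, fP_inr] at hij ⊢

lemma Lbar_of (m n : ℕ) (l₁ l₂ : Mat (m+n) (m+n)) (h1 : T (fP n) l₁)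
    (h2 : BlockTriangular l₂ (fP n)) (h : ∀ i j, fP n i = fP n j → l₁ i j = l₂ i j) :
    (l₁, l₂) ∈ Lbar m n := by
  let A : Mat (m+n) (m+n) → Matrix (Fin n ⊕ Fin m) (Fin n ⊕ Fin m) ℂ := fun l =>
    l.submatrix (fe m n) (fe m n)
  have key : ∀ l : Mat (m+n) (m+n), BlockTriangular l (fP n) →
      (∀ i j, fP n i = fP n j → l₁ i j = l i j) →
      l = Matrix.reindex (fe m n) (fe m n)
        (Matrix.fromBlocks (A l₁).toBlocks₁₁ (A l).toBlocks₁₂ 0 (A l₁).toBlocks₂₂) := by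
    intro l hl hh
    ext i j
    obtain ⟨i, rfl⟩ := (fe m n).surjective i
    obtain ⟨j, rfl⟩ := (fe m n).surjective j
    rcases i with i | i <;> rcases j with j | j <;>
      simp [A, toBlocks₁₁, toBlocks₁₂, toBlocks₂₂]
    · exact (hh _ _ (by simp [fP_inl])).symm
    · exact hl (by simp [fP_inl, fP_inr])
    · exact (hh _ _ (by simp [fP_inr])).symm
  have k1 := key l₁ h1.2 (fun _ _ _ => rfl)
  have k2 := key l₂ h2 h
  have hu := h1.1
  rw [k1, isUnit_block] at hu
  exact ⟨_, _, _, _, hu.1, hu.2, k1, k2⟩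

lemma Lbar_T (m n : ℕ) (l : Mat (m+n) (m+n) × Mat (m+n) (m+n)) (h : l ∈ Lbar m n) :
    T (fP n) l.1 ∧ T (fP n) l.2 ∧ ∀ i j, fP n i = fP n j → l.1 i j = l.2 i j := by
  obtain ⟨a, c, b₁, b₂, ha, hc, e1, e2⟩ := h
  rw [e1, e2]
  refine ⟨⟨(isUnit_block ..).2 ⟨ha, hc⟩, tri_block ..⟩,
    ⟨(isUnit_block ..).2 ⟨ha, hc⟩, tri_block ..⟩, ?_⟩
  intro i j hij
  obtain ⟨i, rfl⟩ := (fe m n).surjective i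
  obtain ⟨j, rfl⟩ := (fe m n).surjective j
  rcases i with i | i <;> rcases j with j | j <;> simp [fP_inl, fP_inr] at hij ⊢

lemma Lbar_mul (m n : ℕ) (l l' : Mat (m+n) (m+n) × Mat (m+n) (m+n)) (h : l ∈ Lbar m n)
    (h' : l' ∈ Lbar m n) : (l.1 * l'.1, l.2 * l'.2) ∈ Lbar m n := by
  obtain ⟨a, c, b₁, b₂, ha, hc, e1, e2⟩ := h
  obtain ⟨a', c', b₁', b₂', ha', hc', e1', e2'⟩ := h'
  refine ⟨a * a', c * c', a * b₁' + b₁ * c', a * b₂' + b₂ * c', ha.mul ha', hc.mul hc', ?_, ?_⟩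
  · simp [e1, e1', Matrix.submatrix_mul_equiv, fromBlocks_multiply]
  · simp [e2, e2', Matrix.submatrix_mul_equiv, fromBlocks_multiply]

lemma Lbar_inv (m n : ℕ) (l : Mat (m+n) (m+n) × Mat (m+n) (m+n)) (h : l ∈ Lbar m n) :
    (l.1⁻¹, l.2⁻¹) ∈ Lbar m n := by
  obtain ⟨a, c, b₁, b₂, ha, hc, e1, e2⟩ := h
  refine ⟨a⁻¹, c⁻¹, -(a⁻¹ * b₁ * c⁻¹), -(a⁻¹ * b₂ * c⁻¹), Matrix.isUnit_nonsing_inv_iff.2 ha, Matrix.isUnit_nonsing_inv_iff.2 hc,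
    ?_, ?_⟩
  · rw [e1, Matrix.reindex_apply, Matrix.inv_submatrix_equiv,
      inv_fromBlocks_zero₂₁_of_isUnit_iff _ _ _ (iff_of_true ha hc)]; rfl
  · rw [e2, Matrix.reindex_apply, Matrix.inv_submatrix_equiv,
      inv_fromBlocks_zero₂₁_of_isUnit_iff _ _ _ (iff_of_true ha hc)]; rfl

/-- cancel: from `b w l = b' w' l'` to `b'⁻¹ b w = w' (l' l⁻¹)` -/
lemma cancel {b b' l l' w w' : Mat N N} (hb' : IsUnit b') (hl : IsUnit l)
    (h : b * w * l = b' * w' * l') : b'⁻¹ * b * w = w' * (l' * l⁻¹) := by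
  calc b'⁻¹ * b * w = b'⁻¹ * (b * w * (l * l⁻¹)) := by
        rw [mul_inv' hl]; simp only [Matrix.mul_assoc, Matrix.mul_one]
    _ = b'⁻¹ * (b * w * l) * l⁻¹ := by simp only [Matrix.mul_assoc]
    _ = (b'⁻¹ * b') * w' * (l' * l⁻¹) := by rw [h]; simp only [Matrix.mul_assoc]
    _ = _ := by rw [inv_mul' hb']; simp only [Matrix.one_mul]

lemma fB_to_fP (n : ℕ) (hn : n ≤ N) {M : Mat N N} (h : T (fB n) M) : T (fP n) M :=
  ⟨h.1, fun i j hij => h.2 ((fB_lt n hn i j).2 (Or.inl hij))⟩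

lemma permMat_T (n : ℕ) (ρ : Equiv.Perm (Fin N)) (hρ : ∀ j, fP n (ρ j) = fP n j) :
    T (fP n) (permMat N ρ) := by
  refine ⟨permMat_isUnit ρ, fun i j hij => ?_⟩
  refine if_neg ?_
  rintro rfl
  rw [hρ] at hij
  exact lt_irrefl _ hij

end St2

open St2 in
theorem statement2 (m n : ℕ) (hm : 0 < m) (hn : 0 < n)
    (g₁ g₂ : Mat (m+n) (m+n)) (h₁ : IsUnit g₁) (h₂ : IsUnit g₂) :
    ∃! p : Equiv.Perm (Fin (m+n)) × Equiv.Perm (Fin (m+n)),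
      headMono n p.2 ∧ tailMono n p.2 ∧
      ∃ bp ∈ Bp (m+n), ∃ bm ∈ Bm (m+n), ∃ l ∈ Lbar m n,
        g₁ = bp * permMat (m+n) p.1 * l.1 ∧ g₂ = bm * permMat (m+n) p.2 * l.2 := by
  have hnN : n ≤ m + n := Nat.le_add_left _ _
  apply existsUnique_of_exists_of_unique
  · obtain ⟨bm, p, hbm, hp, w, e2⟩ := bruhat rL (fB n) rL_inj (fB_inj n hnN) g₂ h₂
    obtain ⟨ρ, hρ, hmono⟩ := sort_exists n w
    set w₂ := w * ρ with hw₂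
    have hρi : ∀ j, fP n (ρ⁻¹ j) = fP n j := fun j => by
      rw [← hρ (ρ⁻¹ j)]; simp
    set q := permMat (m+n) ρ⁻¹ * p with hq
    have hqT : T (fP n) q := (permMat_T n _ hρi).mul (fB_to_fP n hnN hp)
    have e2' : g₂ = bm * permMat (m+n) w₂ * q := by
      rw [hq, ← Matrix.mul_assoc, Matrix.mul_assoc bm, permMat_comp, hw₂]
      simpa using e2
    obtain ⟨bp, t, hbp, ht, w₁, e1⟩ := bruhat rU (fB n) rU_inj (fB_inj n hnN) (g₁ * q⁻¹)
      (h₁.mul hqT.inv.1)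
    let x : Mat (m+n) (m+n) := fun i j => if fP n i = fP n j then t i j else 0
    have hx : (t, x) ∈ Lbar m n := by
      refine Lbar_of m n t x (fB_to_fP n hnN ht) ?_ ?_
      · intro i j hij
        exact if_neg hij.ne'
      · intro i j hij
        exact (if_pos hij).symm
    have hxu : IsUnit x := (Lbar_T m n _ hx).2.1.1
    let y := permMat (m+n) w₂ * x * permMat (m+n) w₂⁻¹
    have hy : T rL y := by
      refine ⟨((permMat_isUnit _).mul hxu).mul (permMat_isUnit _), fun i j hij => ?_⟩
      obtain ⟨i, rfl⟩ := w₂.surjective i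
      obtain ⟨j, rfl⟩ := w₂.surjective j
      have : y (w₂ i) (w₂ j) = x i j := by
        simp only [y]
        rw [mul_permMat, permMat_mul]; simp
      rw [this]
      by_cases hf : fP n i = fP n j
      · simp only [x, if_pos hf]
        refine ht.2 ((fB_lt n hnN i j).2 (Or.inr ⟨hf, ?_⟩))
        by_contra hcon
        rcases (not_lt.1 hcon).eq_or_lt with h | h
        · subst h; exact lt_irrefl _ hij
        · have := hmono j i h hf.symm
          rw [Fin.lt_def] at this
          simp only [rL] at hij
          omega
      · exact if_neg hf
    have hyw : y * permMat (m+n) w₂ = permMat (m+n) w₂ * x := by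
      simp only [y]
      rw [Matrix.mul_assoc, permMat_comp]; simp [permMat_one]
    have hqL : (q, q) ∈ Lbar m n := Lbar_of m n q q hqT hqT.2 (fun _ _ _ => rfl)
    refine ⟨(w₁, w₂), ?_⟩
    obtain ⟨hh, ht'⟩ := (mono_iff n w₂).2 hmono
    refine ⟨hh, ht', bp, (mem_Bp _).2 hbp, bm * y⁻¹, (mem_Bm _).2 (hbm.mul hy.inv),
      (t * q, x * q), Lbar_mul m n _ _ hx hqL, ?_, ?_⟩
    · have : g₁ = g₁ * q⁻¹ * q := by
        rw [Matrix.mul_assoc, inv_mul' hqT.1, Matrix.mul_one]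
      rw [this, e1]
      simp only [Matrix.mul_assoc]
    · calc g₂ = bm * (y⁻¹ * y) * permMat (m+n) w₂ * q := by
            rw [inv_mul' hy.1, Matrix.mul_one]; exact e2'
        _ = bm * y⁻¹ * (y * permMat (m+n) w₂) * q := by simp only [Matrix.mul_assoc]
        _ = _ := by rw [hyw]; simp only [Matrix.mul_assoc]
  · rintro ⟨w₁, w₂⟩ ⟨v₁, v₂⟩ ⟨hh, ht, b, hb, c, hc, l, hl, e1, e2⟩
      ⟨hh', ht', b', hb', c', hc', l', hl', e1', e2'⟩
    have hm := (mono_iff n w₂).1 ⟨hh, ht⟩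
    have hm' := (mono_iff n v₂).1 ⟨hh', ht'⟩
    rw [mem_Bp] at hb hb'
    rw [mem_Bm] at hc hc'
    obtain ⟨t1, t2, -⟩ := Lbar_T m n l hl
    have hQ := Lbar_mul m n _ _ hl' (Lbar_inv m n l hl)
    obtain ⟨s1, s2, s3⟩ := Lbar_T m n _ hQ
    have k1 := cancel hb'.1 t1.1 (e1.symm.trans e1')
    have k2 := cancel hc'.1 t2.1 (e2.symm.trans e2')
    obtain ⟨ρ, hρ, hρP⟩ := uniq rL (fP n) rL_inj _ _ (hc'.inv.mul hc) s2 _ _ k2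
    have hw : w₂ = v₂ := mono_unique n w₂ v₂ ρ hρ hρP hm hm'
    have hB : T (fB n) (l'.1 * l.1⁻¹) := by
      refine ⟨s1.1, fun i j hij => ?_⟩
      rcases (fB_lt n hnN i j).1 hij with h | ⟨hf, h⟩
      · exact s1.2 h
      · have e : (l'.1 * l.1⁻¹) i j = (l'.2 * l.2⁻¹) i j := s3 i j hf
        rw [e, ← permMat_mul v₂ (l'.2 * l.2⁻¹) i j, ← k2, mul_permMat]
        refine (hc'.inv.mul hc).2 ?_
        have := hm i j h hf
        rw [Fin.lt_def] at this
        simp only [rL]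
        rw [← hw]
        omega
    obtain ⟨τ, hτ, hτB⟩ := uniq rU (fB n) rU_inj _ _ (hb'.inv.mul hb) hB _ _ k1
    have hτ1 : τ = 1 := Equiv.ext fun j => fB_inj n hnN (hτB j)
    rw [hτ1, mul_one] at hτ
    exact Prod.ext hτ hw
end
end
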